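/- arXiv:1606.05755 — 4 statements merged into one kernel-verified Lean document; each statement's English description precedes it below -/
import Mathlib

section
/- Consider the (non-impulsive) scalar delay differential equation (E₀) x′(t) + a(t)x(t) = f(t,x_t), t ≥ 0. Assume ∫₀^∞ a(u) du = ∞, assume A := limsup_{t→∞} ∫_{t−τ(t)}^t a(u) du < ∞, and assume the Yorke condition −a(t)·M_t(φ) ≤ f(t,φ) ≤ a(t)·M_t(−φ) for all t ≥ 0 and all φ, where M_t(φ) := max{0, sup_{θ∈[−τ(t),0]} φ(θ)}. Then the zero solution of (E₀) is globally asymptotically stable: it is stable, and every solution of (E₀) on [t₀,∞) (for every t₀ ≥ 0) tends to 0 as t → ∞. -/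
open Filter Set

noncomputable section

/-- A solution of the (non-impulsive) scalar DDE (E₀) on `[t₀,∞)`. -/
def IsSolution0 (a : ℝ → ℝ) (f : ℝ → (ℝ → ℝ) → ℝ) (t₀ : ℝ) (x : ℝ → ℝ) : Prop :=
  (∃ M, ∀ s ≤ t₀, |x s| ≤ M) ∧
  ContinuousOn x (Set.Ici t₀) ∧
  (∀ t > t₀, HasDerivAt x (f t (fun θ => x (t + θ)) - a t * x t) t)

/-- Yorke's functional `M_t(φ) = max{0, sup_{θ ∈ [−r,0]} φ(θ)}`. -/
def yorkeM (r : ℝ) (φ : ℝ → ℝ) : ℝ := max 0 (sSup (φ '' Set.Icc (-r) 0))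

/-- One half of the differential inequality that Yorke's condition imposes on a solution: where
`-B ≤ x` on the delay window, the derivative of `x` is at most `a * (B - x)`. -/
def UpperYorke (a τ : ℝ → ℝ) (t₀ : ℝ) (x : ℝ → ℝ) : Prop :=
  ∀ t > t₀, ∀ B ≥ (0 : ℝ), (∀ s ∈ Icc (t - τ t) t, -B ≤ x s) →
    DifferentiableAt ℝ x t ∧ deriv x t ≤ a t * (B - x t)

lemma yorkeM_le {r B : ℝ} {φ : ℝ → ℝ} (hr : 0 ≤ r) (hB : 0 ≤ B)
    (h : ∀ θ ∈ Icc (-r) 0, φ θ ≤ B) : yorkeM r φ ≤ B := by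
  refine max_le hB (csSup_le ⟨φ 0, 0, ⟨by linarith, le_rfl⟩, rfl⟩ ?_)
  rintro _ ⟨θ, hθ, rfl⟩
  exact h θ hθ

lemma yorkeM_congr {r : ℝ} {φ ψ : ℝ → ℝ} (h : ∀ θ ∈ Icc (-r) 0, φ θ = ψ θ) :
    yorkeM r φ = yorkeM r ψ := by
  unfold yorkeM
  rw [image_congr h]

/-- Grönwall-type estimate for `x' ≤ a (b - x)`. -/
lemma sub_le_exp_mul_sub {a x : ℝ → ℝ} {p q b : ℝ} (ha : ContinuousOn a (Ici 0)) (hp : 0 ≤ p)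
    (hpq : p ≤ q) (hx : ContinuousOn x (Icc p q))
    (hd : ∀ t ∈ Ioo p q, DifferentiableAt ℝ x t ∧ deriv x t ≤ a t * (b - x t)) :
    x q - b ≤ Real.exp (-∫ u in p..q, a u) * (x p - b) := by
  set c : ℝ → ℝ := fun t => a (max 0 t) with hc_def
  have hc : Continuous c := by
    refine ha.comp_continuous (by fun_prop) fun t => ?_
    exact le_max_left (0 : ℝ) t
  have hca : ∀ t, 0 ≤ t → c t = a t := fun t ht => by simp [hc_def, max_eq_right ht]
  have hint : ∫ u in p..q, a u = ∫ u in p..q, c u := by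
    refine intervalIntegral.integral_congr fun t ht => ?_
    rw [uIcc_of_le hpq] at ht
    exact (hca t (hp.trans ht.1)).symm
  have hC : ∀ t, HasDerivAt (fun t => ∫ u in p..t, c u) (c t) t := fun t =>
    intervalIntegral.integral_hasDerivAt_right (hc.intervalIntegrable _ _)
      (hc.stronglyMeasurableAtFilter _ _) hc.continuousAt
  have hCc : Continuous fun t => ∫ u in p..t, c u :=
    continuous_iff_continuousAt.2 fun t => (hC t).continuousAt
  have hanti : AntitoneOn (fun t => Real.exp (∫ u in p..t, c u) * (x t - b)) (Icc p q) := by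
    have hder : ∀ t ∈ Ioo p q, HasDerivAt (fun t => Real.exp (∫ u in p..t, c u) * (x t - b))
        (Real.exp (∫ u in p..t, c u) * c t * (x t - b)
          + Real.exp (∫ u in p..t, c u) * deriv x t) t := fun t ht =>
      (hC t).exp.mul ((hd t ht).1.hasDerivAt.sub_const b)
    refine antitoneOn_of_deriv_nonpos (convex_Icc p q) ?_ ?_ ?_
    · exact (Real.continuous_exp.comp hCc).continuousOn.mul (hx.sub continuousOn_const)
    · rw [interior_Icc]
      exact fun t ht => (hder t ht).differentiableAt.differentiableWithinAt
    · rw [interior_Icc]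
      intro t ht
      rw [(hder t ht).deriv, hca t (hp.trans ht.1.le)]
      have := mul_le_mul_of_nonneg_left (hd t ht).2 (Real.exp_pos (∫ u in p..t, c u)).le
      linarith
  have h := hanti (left_mem_Icc.2 hpq) (right_mem_Icc.2 hpq) hpq
  simp only [intervalIntegral.integral_same, Real.exp_zero, one_mul] at h
  rw [hint, Real.exp_neg, inv_mul_eq_div, le_div_iff₀' (Real.exp_pos _)]
  exact h

lemma integral_nonneg_of_nonneg_Ici {a : ℝ → ℝ} (ha : ∀ t ≥ 0, 0 ≤ a t) {p q : ℝ} (hp : 0 ≤ p)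
    (hpq : p ≤ q) : 0 ≤ ∫ u in p..q, a u :=
  intervalIntegral.integral_nonneg hpq fun u hu => ha u (hp.trans hu.1)

lemma intervalIntegrable_of_continuousOn_Ici {a : ℝ → ℝ} (ha : ContinuousOn a (Ici 0)) {p q : ℝ}
    (hp : 0 ≤ p) (hq : 0 ≤ q) : IntervalIntegrable a MeasureTheory.volume p q :=
  (ha.mono fun _ hu => (le_min hp hq).trans hu.1).intervalIntegrable

/-- A bound on the initial history persists for all later times. -/
lemma UpperYorke.abs_le_of_history {a τ x : ℝ → ℝ} {t₀ M : ℝ} (ha : ContinuousOn a (Ici 0))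
    (ht₀ : 0 ≤ t₀) (hx : ContinuousOn x (Ici t₀)) (hup : UpperYorke a τ t₀ x)
    (hlo : UpperYorke a τ t₀ fun t => -x t) (hM : ∀ s ≤ t₀, |x s| ≤ M) (t : ℝ) :
    |x t| ≤ M := by
  rcases le_total t t₀ with h | htt
  · exact hM t h
  by_contra! hlt
  obtain ⟨p, hp, hmax⟩ := isCompact_Icc.exists_isMaxOn (nonempty_Icc.2 htt)
    (hx.mono (Icc_subset_Ici_self : Icc t₀ t ⊆ Ici t₀)).abs
  have hK : M < |x p| := hlt.trans_le (hmax (right_mem_Icc.2 htt))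
  have hbd : ∀ s ≤ t, |x s| ≤ |x p| := fun s hs => by
    rcases le_total s t₀ with h | h
    · exact (hM s h).trans hK.le
    · exact hmax (show s ∈ Icc t₀ t from ⟨h, hs⟩)
  have hstrict : ∀ y : ℝ → ℝ, ContinuousOn y (Ici t₀) → UpperYorke a τ t₀ y →
      (∀ s ≤ t, |y s| ≤ |x p|) → |y t₀| ≤ M → y p < |x p| := by
    intro y hy hyup hyb hy0
    have h := sub_le_exp_mul_sub (b := |x p|) ha ht₀ hp.1 (hy.mono Icc_subset_Ici_self)
      fun u hu => hyup u hu.1 _ (abs_nonneg _) fun s hs =>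
        (abs_le.1 (hyb s (hs.2.trans (hu.2.le.trans hp.2)))).1
    have h2 : Real.exp (-∫ u in t₀..p, a u) * (y t₀ - |x p|) < 0 :=
      mul_neg_of_pos_of_neg (Real.exp_pos _) (by linarith [le_abs_self (y t₀)])
    linarith
  have h1 := hstrict x hx hup hbd (hM t₀ le_rfl)
  have h2 := hstrict (fun t => -x t) hx.neg hlo (by simpa using hbd) (by simpa using hM t₀ le_rfl)
  rcases abs_cases (x p) with h | h <;> linarith [h.1]

/-- If `x ≥ -V` eventually, then `x ≤ (1 - e^{-A} / 2) V` eventually. -/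
lemma UpperYorke.eventually_le {a τ x : ℝ → ℝ} {t₀ A V : ℝ}
    (hτ_cont : ContinuousOn τ (Ici 0)) (hτ_nonneg : ∀ t ≥ 0, 0 ≤ τ t)
    (hd_top : Tendsto (fun t => t - τ t) atTop atTop)
    (ha : ContinuousOn a (Ici 0)) (ha_nonneg : ∀ t ≥ 0, 0 ≤ a t)
    (hdiv : Tendsto (fun t => ∫ u in (0 : ℝ)..t, a u) atTop atTop)
    (hA : ∀ᶠ t in atTop, ∫ u in (t - τ t)..t, a u ≤ A)
    (hx : ContinuousOn x (Ici t₀)) (hup : UpperYorke a τ t₀ x) (hV : 0 < V)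
    (hlow : ∀ᶠ t in atTop, -V ≤ x t) :
    ∀ᶠ t in atTop, x t ≤ (1 - Real.exp (-A) / 2) * V := by
  have hA0 : 0 ≤ A := by
    obtain ⟨t, h1, h2, h3⟩ :=
      (hA.and ((hd_top.eventually_ge_atTop 0).and (eventually_ge_atTop 0))).exists
    exact (integral_nonneg_of_nonneg_Ici ha_nonneg h2 (by linarith [hτ_nonneg t h3])).trans h1
  have hexp : Real.exp (-A) ≤ 1 := Real.exp_le_one_iff.2 (by linarith)
  by_cases hpos : ∃ S, ∀ s ≥ S, 0 < x s
  · obtain ⟨S, hS⟩ := hpos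
    obtain ⟨T, hT⟩ := eventually_atTop.1 (((hd_top.eventually_ge_atTop S).and
      (eventually_ge_atTop (max t₀ 0))))
    have hTt₀ : t₀ ≤ T := (le_max_left _ _).trans (hT T le_rfl).2
    have hT0 : 0 ≤ T := (le_max_right _ _).trans (hT T le_rfl).2
    have hdecay : ∀ t ≥ T, x t ≤ Real.exp (-∫ u in T..t, a u) * x T := by
      intro t ht
      have h := sub_le_exp_mul_sub (b := 0) ha hT0 ht
        (hx.mono fun s hs => hTt₀.trans hs.1) fun u hu =>
          hup u (hTt₀.trans_lt hu.1) 0 le_rfl fun s hs => by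
            simpa using (hS s ((hT u hu.1.le).1.trans hs.1)).le
      simpa using h
    have hlim : Tendsto (fun t => Real.exp (-∫ u in T..t, a u) * x T) atTop (nhds 0) := by
      have h1 : Tendsto (fun t => ∫ u in T..t, a u) atTop atTop := by
        refine (tendsto_atTop_add_const_right _ (-∫ u in (0 : ℝ)..T, a u) hdiv).congr' ?_
        filter_upwards [eventually_ge_atTop 0] with t ht
        rw [← intervalIntegral.integral_add_adjacent_intervals
          (intervalIntegrable_of_continuousOn_Ici ha le_rfl hT0)
          (intervalIntegrable_of_continuousOn_Ici ha hT0 ht)]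
        ring
      simpa using (Real.tendsto_exp_neg_atTop_nhds_zero.comp h1).mul_const (x T)
    have hqV : 0 < (1 - Real.exp (-A) / 2) * V := mul_pos (by linarith) hV
    filter_upwards [eventually_ge_atTop T, hlim.eventually_le_const hqV] with t ht h
    exact (hdecay t ht).trans h
  · push Not at hpos
    obtain ⟨T₁, hT₁⟩ := eventually_atTop.1 hlow
    obtain ⟨T, hT⟩ := eventually_atTop.1 ((hd_top.eventually_ge_atTop (max T₁ 0)).and
      (hA.and (eventually_ge_atTop (max t₀ 0))))
    obtain ⟨t₁, ht₁, hxt₁⟩ := hpos T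
    have h0 : ∀ {s}, t₁ ≤ s → 0 ≤ s := fun hs =>
      (le_max_right t₀ 0).trans (hT _ (ht₁.trans hs)).2.2
    have ht₀s : ∀ {s}, t₁ ≤ s → t₀ ≤ s := fun hs =>
      (le_max_left t₀ 0).trans (hT _ (ht₁.trans hs)).2.2
    filter_upwards [eventually_ge_atTop t₁] with t ht
    have hsuff : x t ≤ (1 - Real.exp (-A)) * V → x t ≤ (1 - Real.exp (-A) / 2) * V := by
      intro h
      nlinarith [mul_pos (Real.exp_pos (-A)) hV]
    apply hsuff
    -- `ξ` is the last time up to `t` at which `x` is nonpositive.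
    obtain ⟨ξ, ⟨hξ, hxξ⟩, hξmax⟩ : ∃ ξ, IsGreatest (Icc t₁ t ∩ x ⁻¹' Iic 0) ξ := by
      have hcl : IsClosed (Icc t₁ t ∩ x ⁻¹' Iic 0) :=
        (hx.mono fun s hs => ht₀s hs.1).preimage_isClosed_of_isClosed isClosed_Icc isClosed_Iic
      exact (isCompact_Icc.of_isClosed_subset hcl inter_subset_left).exists_isGreatest
        ⟨t₁, left_mem_Icc.2 ht, hxt₁⟩
    have hxpos : ∀ s, ξ < s → s ≤ t → 0 < x s := fun s hs hst => by
      by_contra! hle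
      exact absurd (hξmax ⟨⟨hξ.1.trans hs.le, hst⟩, hle⟩) (not_le.2 hs)
    -- `r` is the last time up to `t` whose delay window reaches back to `ξ`.
    obtain ⟨r, ⟨hr, hdr⟩, hrmax⟩ :
        ∃ r, IsGreatest (Icc ξ t ∩ (fun s => s - τ s) ⁻¹' Iic ξ) r := by
      have hcl : IsClosed (Icc ξ t ∩ (fun s => s - τ s) ⁻¹' Iic ξ) :=
        (continuousOn_id.sub (hτ_cont.mono fun s hs =>
          h0 (hξ.1.trans hs.1))).preimage_isClosed_of_isClosed isClosed_Icc isClosed_Iic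
      refine (isCompact_Icc.of_isClosed_subset hcl inter_subset_left).exists_isGreatest
        ⟨ξ, left_mem_Icc.2 hξ.2, ?_⟩
      have := hτ_nonneg ξ (h0 hξ.1)
      simp only [mem_preimage, mem_Iic]
      linarith
    simp only [mem_preimage, mem_Iic] at hxξ hdr
    have hξ0 := h0 hξ.1
    have hr1 : t₁ ≤ r := hξ.1.trans hr.1
    have hxr : x r ≤ (1 - Real.exp (-A)) * V := by
      have h := sub_le_exp_mul_sub (b := V) ha hξ0 hr.1
        (hx.mono fun s hs => ht₀s (hξ.1.trans hs.1)) fun u hu =>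
          hup u ((ht₀s hξ.1).trans_lt hu.1) V hV.le fun s hs =>
            hT₁ s ((le_max_left _ _).trans
              ((hT u (ht₁.trans (hξ.1.trans hu.1.le))).1.trans hs.1))
      have hdr0 : 0 ≤ r - τ r := (le_max_right _ _).trans (hT r (ht₁.trans hr1)).1
      have hint : ∫ u in ξ..r, a u ≤ A := by
        have h1 := (hT r (ht₁.trans hr1)).2.1
        rw [← intervalIntegral.integral_add_adjacent_intervals
          (intervalIntegrable_of_continuousOn_Ici ha hdr0 hξ0)
          (intervalIntegrable_of_continuousOn_Ici ha hξ0 (h0 hr1))] at h1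
        linarith [integral_nonneg_of_nonneg_Ici ha_nonneg hdr0 hdr]
      have hexp' : Real.exp (-A) ≤ Real.exp (-∫ u in ξ..r, a u) :=
        Real.exp_le_exp.2 (by linarith)
      have h2 : Real.exp (-∫ u in ξ..r, a u) * (x ξ - V) ≤ Real.exp (-A) * (-V) := by
        have := mul_le_mul_of_nonneg_right hexp' hV.le
        have := mul_le_mul_of_nonneg_left hxξ (Real.exp_pos (-∫ u in ξ..r, a u)).le
        linarith
      linarith
    have hw : 0 ≤ (1 - Real.exp (-A)) * V := mul_nonneg (by linarith) hV.le
    have h := sub_le_exp_mul_sub (b := 0) ha (h0 hr1) hr.2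
      (hx.mono fun s hs => ht₀s (hr1.trans hs.1)) fun u hu =>
        hup u ((ht₀s hr1).trans_lt hu.1) 0 le_rfl fun s hs => by
          have hdu : ξ < u - τ u := by
            by_contra! hle
            exact absurd (hrmax ⟨⟨hr.1.trans hu.1.le, hu.2.le⟩, hle⟩) (not_le.2 hu.1)
          simpa using (hxpos s (hdu.trans_le hs.1) (hs.2.trans hu.2.le)).le
    have hE : Real.exp (-∫ u in r..t, a u) ≤ 1 := Real.exp_le_one_iff.2
      (neg_nonpos.2 (integral_nonneg_of_nonneg_Ici ha_nonneg (h0 hr1) hr.2))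
    have h3 := mul_le_mul_of_nonneg_left hxr (Real.exp_pos (-∫ u in r..t, a u)).le
    have h4 := mul_le_of_le_one_left hw hE
    linarith

/-- A function subject to both Yorke inequalities and bounded on the past tends to zero. -/
lemma UpperYorke.tendsto_zero {a τ x : ℝ → ℝ} {t₀ A M : ℝ}
    (hτ_cont : ContinuousOn τ (Ici 0)) (hτ_nonneg : ∀ t ≥ 0, 0 ≤ τ t)
    (hd_top : Tendsto (fun t => t - τ t) atTop atTop)
    (ha : ContinuousOn a (Ici 0)) (ha_nonneg : ∀ t ≥ 0, 0 ≤ a t)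
    (hdiv : Tendsto (fun t => ∫ u in (0 : ℝ)..t, a u) atTop atTop)
    (hA : ∀ᶠ t in atTop, ∫ u in (t - τ t)..t, a u ≤ A) (hA0 : 0 ≤ A)
    (ht₀ : 0 ≤ t₀) (hx : ContinuousOn x (Ici t₀)) (hup : UpperYorke a τ t₀ x)
    (hlo : UpperYorke a τ t₀ fun t => -x t) (hM : ∀ s ≤ t₀, |x s| ≤ M) :
    Tendsto x atTop (nhds 0) := by
  have hexp : Real.exp (-A) ≤ 1 := Real.exp_le_one_iff.2 (by linarith)
  set q := 1 - Real.exp (-A) / 2 with hq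
  have hq0 : 0 < q := by linarith
  have hq1 : q < 1 := by linarith [Real.exp_pos (-A)]
  have hM0 : 0 ≤ M := (abs_nonneg _).trans (hM t₀ le_rfl)
  have hiter : ∀ n : ℕ, ∀ᶠ t in atTop, |x t| ≤ q ^ n * (M + 1) := by
    intro n
    induction n with
    | zero =>
      refine Eventually.of_forall fun t => ?_
      linarith [UpperYorke.abs_le_of_history ha ht₀ hx hup hlo hM t, pow_zero q]
    | succ n ih =>
      have hV : 0 < q ^ n * (M + 1) := by positivity
      have h1 := hup.eventually_le hτ_cont hτ_nonneg hd_top ha ha_nonneg hdiv hA hx hV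
        (ih.mono fun t h => (abs_le.1 h).1)
      have h2 := hlo.eventually_le hτ_cont hτ_nonneg hd_top ha ha_nonneg hdiv hA hx.neg hV
        (ih.mono fun t h => neg_le_neg (abs_le.1 h).2)
      filter_upwards [h1, h2] with t h1 h2
      rw [pow_succ, mul_comm (q ^ n) q, mul_assoc]
      exact abs_le'.2 ⟨h1, h2⟩
  have hlim : Tendsto (fun n : ℕ => q ^ n * (M + 1)) atTop (nhds 0) := by
    simpa using (tendsto_pow_atTop_nhds_zero_of_lt_one hq0.le hq1).mul_const (M + 1)
  rw [Metric.tendsto_nhds]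
  intro ε hε
  obtain ⟨n, hn⟩ := (hlim.eventually_lt_const hε).exists
  filter_upwards [hiter n] with t ht
  simpa using ht.trans_lt hn

/-- Solutions of the delay equation satisfy both halves of the Yorke inequality. -/
lemma IsSolution0.upperYorke {τ a x : ℝ → ℝ} {f : ℝ → (ℝ → ℝ) → ℝ} {t₀ : ℝ}
    (hτ_nonneg : ∀ t ≥ 0, 0 ≤ τ t) (ha_nonneg : ∀ t ≥ 0, 0 ≤ a t)
    (hf_dep : ∀ t ≥ 0, ∀ φ ψ : ℝ → ℝ,
      (∀ θ ∈ Icc (-τ t) 0, φ θ = ψ θ) → f t φ = f t ψ)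
    (hYorke : ∀ t ≥ (0:ℝ), ∀ φ : ℝ → ℝ, (∃ M, ∀ θ : ℝ, |φ θ| ≤ M) →
      -a t * yorkeM (τ t) φ ≤ f t φ ∧
      f t φ ≤ a t * yorkeM (τ t) (fun θ => -φ θ))
    (ht₀ : 0 ≤ t₀) (hsol : IsSolution0 a f t₀ x) :
    UpperYorke a τ t₀ x ∧ UpperYorke a τ t₀ fun t => -x t := by
  obtain ⟨⟨M, hM⟩, hx, hder⟩ := hsol
  have key : ∀ t > t₀,
      -a t * yorkeM (τ t) (fun θ => x (t + θ)) ≤ f t (fun θ => x (t + θ)) ∧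
      f t (fun θ => x (t + θ)) ≤ a t * yorkeM (τ t) (fun θ => -x (t + θ)) := by
    intro t ht
    obtain ⟨K, hK⟩ := isCompact_Icc.exists_bound_of_continuousOn
      (hx.mono (Icc_subset_Ici_self : Icc t₀ t ⊆ Ici t₀))
    set ψ : ℝ → ℝ := fun θ => x (t + min θ 0) with hψ
    have heq : ∀ θ ∈ Icc (-τ t) 0, x (t + θ) = ψ θ := fun θ hθ => by
      simp [hψ, min_eq_left hθ.2]
    have hbd : ∃ M, ∀ θ : ℝ, |ψ θ| ≤ M := by
      refine ⟨max M K, fun θ => ?_⟩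
      rcases le_total (t + min θ 0) t₀ with h | h
      · exact (hM _ h).trans (le_max_left _ _)
      · exact (hK _ ⟨h, by linarith [min_le_right θ 0]⟩).trans (le_max_right _ _)
    have h := hYorke t (ht₀.trans ht.le) ψ hbd
    rw [hf_dep t (ht₀.trans ht.le) _ ψ heq, yorkeM_congr heq,
      yorkeM_congr fun θ hθ => congrArg Neg.neg (heq θ hθ)]
    exact h
  have hmem : ∀ {t θ : ℝ}, θ ∈ Icc (-τ t) 0 → t + θ ∈ Icc (t - τ t) t := fun h =>
    ⟨by linarith [h.1], by linarith [h.2]⟩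
  constructor
  · intro t ht B hB h
    have h0 := ht₀.trans ht.le
    refine ⟨(hder t ht).differentiableAt, ?_⟩
    rw [(hder t ht).deriv]
    have h1 : yorkeM (τ t) (fun θ => -x (t + θ)) ≤ B :=
      yorkeM_le (hτ_nonneg t h0) hB fun θ hθ => by linarith [h _ (hmem hθ)]
    linarith [(key t ht).2, mul_le_mul_of_nonneg_left h1 (ha_nonneg t h0)]
  · intro t ht B hB h
    have h0 := ht₀.trans ht.le
    refine ⟨(hder t ht).neg.differentiableAt, ?_⟩
    rw [show deriv (fun t => -x t) t = _ from (hder t ht).neg.deriv]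
    have h1 : yorkeM (τ t) (fun θ => x (t + θ)) ≤ B :=
      yorkeM_le (hτ_nonneg t h0) hB fun θ hθ => by linarith [h _ (hmem hθ)]
    linarith [(key t ht).1, mul_le_mul_of_nonneg_left h1 (ha_nonneg t h0)]

theorem corollary23_tang_criterion
    (τ a : ℝ → ℝ) (f : ℝ → (ℝ → ℝ) → ℝ)
    (hτ_cont : ContinuousOn τ (Set.Ici 0)) (hτ_nonneg : ∀ t ≥ 0, 0 ≤ τ t)
    (hd_mono : MonotoneOn (fun t => t - τ t) (Set.Ici 0))
    (hd_top : Tendsto (fun t => t - τ t) atTop atTop)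
    (ha_cont : ContinuousOn a (Set.Ici 0)) (ha_nonneg : ∀ t ≥ 0, 0 ≤ a t)
    (hf_dep : ∀ t ≥ 0, ∀ φ ψ : ℝ → ℝ,
      (∀ θ ∈ Set.Icc (-τ t) 0, φ θ = ψ θ) → f t φ = f t ψ)
    -- ∫₀^∞ a(u) du = ∞
    (hH2ii : Tendsto (fun t => ∫ u in (0:ℝ)..t, a u) atTop atTop)
    -- A = limsup_{t→∞} ∫_{t−τ(t)}^t a(u) du < ∞
    (hA : Filter.limsup
      (fun t : ℝ => ENNReal.ofReal (∫ u in (t - τ t)..t, a u)) atTop < ⊤)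
    -- the Yorke condition with λ₁ = λ₂ = a
    (hYorke : ∀ t ≥ (0:ℝ), ∀ φ : ℝ → ℝ, (∃ M, ∀ θ : ℝ, |φ θ| ≤ M) →
      -a t * yorkeM (τ t) φ ≤ f t φ ∧
      f t φ ≤ a t * yorkeM (τ t) (fun θ => -φ θ)) :
    -- the zero solution is stable
    (∀ ε > (0:ℝ), ∀ t₀ ≥ (0:ℝ), ∃ δ > (0:ℝ), ∀ x : ℝ → ℝ,
      IsSolution0 a f t₀ x → (∀ s ≤ t₀, |x s| < δ) →
        ∀ t ≥ t₀, |x t| < ε) ∧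
    -- and globally attractive
    (∀ t₀ ≥ (0:ℝ), ∀ x : ℝ → ℝ, IsSolution0 a f t₀ x →
      Tendsto x atTop (nhds 0)) := by
  have hsol : ∀ t₀ ≥ (0 : ℝ), ∀ x, IsSolution0 a f t₀ x →
      UpperYorke a τ t₀ x ∧ UpperYorke a τ t₀ fun t => -x t := fun t₀ ht₀ x hx =>
    hx.upperYorke hτ_nonneg ha_nonneg hf_dep hYorke ht₀
  refine ⟨fun ε hε t₀ ht₀ => ⟨ε / 2, half_pos hε, fun x hx hs t _ => ?_⟩, fun t₀ ht₀ x hx => ?_⟩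
  · obtain ⟨hup, hlo⟩ := hsol t₀ ht₀ x hx
    have := UpperYorke.abs_le_of_history ha_cont ht₀ hx.2.1 hup hlo (fun s h => (hs s h).le) t
    linarith
  · obtain ⟨hup, hlo⟩ := hsol t₀ ht₀ x hx
    obtain ⟨M, hM⟩ := hx.1
    obtain ⟨A, hA1, hA2⟩ := ENNReal.lt_iff_exists_nnreal_btwn.1 hA
    have hbd : ∀ᶠ t in atTop, ∫ u in (t - τ t)..t, a u ≤ (A : ℝ) := by
      filter_upwards [eventually_lt_of_limsup_lt hA1] with t ht
      exact Real.toNNReal_le_iff_le_coe.1 (ENNReal.coe_le_coe.1 ht.le)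
    exact hup.tendsto_zero hτ_cont hτ_nonneg hd_top ha_cont ha_nonneg hH2ii hbd A.2
      ht₀ hx.2.1 hlo hM
end
end

section
/- Assume (f₀), (i₀), (i₁), (i₂), and let N* be a positive ω-periodic solution of the impulsive Lasota–Wazewska equation (LW). If Σ_{i=1}^n β_i(t)·b_i(t)·max_{θ∈[−τ_i(t),0]} ∏_{k : t+θ ≤ t_k < t} (1+b_k)⁻¹ ≤ a(t) for all t ≥ 0, then N* is globally attractive: every positive solution N of (LW) on [0,∞) satisfies N(t) − N*(t) → 0 as t → ∞. -/
open Filter Set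

noncomputable section

/-- `τ̄ = max_{i,t} τ_i(t)`. -/
def taubar {n : ℕ} (τi : Fin (n + 1) → ℝ → ℝ) : ℝ :=
  sSup {x : ℝ | ∃ i : Fin (n + 1), ∃ t : ℝ, τi i t = x}

/-- `τ(t) = max_{1 ≤ i ≤ n} τ_i(t)`. -/
def tauMax {n : ℕ} (τi : Fin (n + 1) → ℝ → ℝ) (t : ℝ) : ℝ :=
  Finset.univ.sup' Finset.univ_nonempty fun i => τi i t

/-- `B_i(t) = max_{θ ∈ [−τ_i(t),0]} ∏_{k : t+θ ≤ t_k < t} (1+b_k)⁻¹`. -/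
def BfunLW (tk : ℕ → ℝ) (bb : ℕ → ℝ) (τ : ℝ → ℝ) (t : ℝ) : ℝ :=
  sSup ((fun θ : ℝ => ∏ᶠ k ∈ {k : ℕ | t + θ ≤ tk k ∧ tk k < t}, (1 + bb k)⁻¹) ''
    Set.Icc (-τ t) 0)

/-- A positive solution of the impulsive Lasota–Wazewska equation (LW) on `[t₀,∞)`. -/
def IsPosSolLW {n : ℕ} (a : ℝ → ℝ) (b β τi : Fin (n + 1) → ℝ → ℝ)
    (tk : ℕ → ℝ) (I : ℕ → ℝ → ℝ) (t₀ : ℝ) (N : ℝ → ℝ) : Prop :=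
  ContinuousOn N (Set.Icc (t₀ - taubar τi) t₀) ∧
  (∀ t ∈ Set.Icc (t₀ - taubar τi) t₀, 0 < N t) ∧
  (∀ t > t₀, 0 < N t) ∧
  (∀ t > t₀, ContinuousWithinAt N (Set.Iic t) t) ∧
  (∀ t > t₀, ∃ L, Tendsto N (nhdsWithin t (Set.Ioi t)) (nhds L)) ∧
  (∀ t > t₀, (∀ k, t ≠ tk k) → ContinuousAt N t) ∧
  (∀ t > t₀, DifferentiableWithinAt ℝ N (Set.Iic t) t) ∧
  (∀ t > t₀, (∀ k, t ≠ tk k) →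
    derivWithin N (Set.Iic t) t + a t * N t =
      ∑ i, b i t * Real.exp (-(β i t * N (t - τi i t)))) ∧
  (∀ k, tk k > t₀ →
    Tendsto N (nhdsWithin (tk k) (Set.Ioi (tk k))) (nhds (N (tk k) + I k (N (tk k)))))

/-- A continuous function whose left derivative is negative on `(r, s]` satisfies `u s ≤ u r`. -/
lemma le_of_left_deriv_neg {u u' : ℝ → ℝ} {r s : ℝ} (hrs : r ≤ s)
    (hc : ContinuousOn u (Icc r s))
    (hd : ∀ t ∈ Ioc r s, HasDerivWithinAt u (u' t) (Iic t) t)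
    (hneg : ∀ t ∈ Ioc r s, u' t < 0) : u s ≤ u r := by
  have hmaps : MapsTo (fun t : ℝ => -t) (Icc (-s) (-r)) (Icc r s) := fun t ht =>
    ⟨by linarith [ht.2], by linarith [ht.1]⟩
  have hmem : ∀ t ∈ Ico (-s) (-r), -t ∈ Ioc r s := fun t ht =>
    ⟨by linarith [ht.2], by linarith [ht.1]⟩
  have key := image_le_of_deriv_right_lt_deriv_boundary
    (f := fun t => -u (-t)) (f' := fun t => u' (-t)) (a := -s) (b := -r)
    (B := fun _ => -u s) (B' := fun _ => 0)
    ((hc.comp continuous_neg.continuousOn hmaps).neg)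
    (fun t ht => by
      have h := (hd (-t) (hmem t ht)).scomp t (hasDerivAt_neg t).hasDerivWithinAt
        (s := Ici t) (fun x hx => by
          have hx' : t ≤ x := hx
          show -x ≤ -t
          linarith)
      have h2 := h.neg
      simp only [neg_smul, one_smul, neg_neg] at h2
      exact h2)
    (by simp) (fun t => hasDerivAt_const t _) (fun t ht _ => hneg _ (hmem t ht))
    (right_mem_Icc.2 (neg_le_neg hrs))
  simp only [neg_neg] at key
  linarith

/-- A first crossing of the exponential barrier `C * exp (-(l * t))` from below is impossible. -/
lemma lt_exp_barrier_of_lt_before {y a : ℝ → ℝ} {τ κ l C a₀ t₁ S : ℝ} (hτ : 0 < τ) (hC : 0 < C)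
    (hl : l < a₀ * (1 - κ * Real.exp (l * τ))) (hl0 : 0 < l)
    (ha : Continuous a) (ha₀ : 0 < a₀) (haa : ∀ t, a₀ ≤ a t) (hS : S < t₁ - τ)
    (hy : ContinuousOn y (Ici S))
    (hder : ∀ᶠ s in nhdsWithin t₁ (Iio t₁), ∃ d, HasDerivWithinAt y d (Iic s) s ∧
      ∀ M, (∀ r ∈ Icc (s - τ) s, |y r| ≤ M) → |d + a s * y s| ≤ κ * a s * M)
    (hbef : ∀ s ∈ Ico S t₁, |y s| < C * Real.exp (-(l * s))) :
    y t₁ < C * Real.exp (-(l * t₁)) := by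
  by_contra! hcon
  have hWc : Continuous fun t => C * Real.exp (-(l * t)) := by fun_prop
  have hyt : ContinuousAt y t₁ := hy.continuousAt (Ici_mem_nhds (by linarith))
  have hE : 0 < 1 - κ * Real.exp (l * τ) := by
    by_contra! h
    nlinarith
  have hat : l < a t₁ * (1 - κ * Real.exp (l * τ)) :=
    hl.trans_le (mul_le_mul_of_nonneg_right (haa _) hE.le)
  have hstrict : (κ * a t₁ * Real.exp (l * τ) + l) * (C * Real.exp (-(l * t₁)))
      < a t₁ * y t₁ := by
    have hW : 0 < C * Real.exp (-(l * t₁)) := by positivity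
    have h1 : a t₁ * (C * Real.exp (-(l * t₁))) ≤ a t₁ * y t₁ :=
      mul_le_mul_of_nonneg_left hcon (ha₀.le.trans (haa _))
    nlinarith
  have hev : ∀ᶠ s in nhds t₁,
      (κ * a s * Real.exp (l * τ) + l) * (C * Real.exp (-(l * s))) < a s * y s := by
    refine ContinuousAt.eventually_lt ?_ (ha.continuousAt.mul hyt) hstrict
    exact Continuous.continuousAt (by fun_prop)
  have hev2 : ∀ᶠ s in nhdsWithin t₁ (Iio t₁), S + τ < s :=
    (eventually_gt_nhds (by linarith)).filter_mono nhdsWithin_le_nhds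
  obtain ⟨r₀, hr₀, hall⟩ := (mem_nhdsLT_iff_exists_Ioo_subset (a := t₁)).1
    (((hder.and (hev.filter_mono nhdsWithin_le_nhds))).and hev2)
  have hr₀' : r₀ < t₁ := hr₀
  obtain ⟨r, hr1, hr2⟩ := exists_between hr₀'
  set u : ℝ → ℝ := fun t => y t - C * Real.exp (-(l * t)) with hu
  have hrS : S + τ < r := (hall ⟨hr1, hr2⟩).2
  have hur : u r < 0 := by
    have := hbef r ⟨by linarith, hr2⟩
    have := le_abs_self (y r)
    simp only [hu]
    linarith
  have huc : ContinuousOn u (Ici S) := hy.sub hWc.continuousOn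
  have hderu : ∀ t ∈ Ioo r₀ t₁, ∃ d, HasDerivWithinAt u d (Iic t) t ∧ d < 0 := by
    intro t ht
    obtain ⟨⟨⟨d, hd, hdM⟩, hlt⟩, hSt⟩ := hall ht
    have hSt : S + τ < t := hSt
    have hb := hdM (C * Real.exp (-(l * (t - τ)))) (fun r hr => by
      refine (hbef r ⟨by linarith [hr.1], by linarith [hr.2, ht.2]⟩).le.trans ?_
      gcongr
      exact hr.1)
    have hWd : HasDerivAt (fun t => C * Real.exp (-(l * t)))
        (C * (Real.exp (-(l * t)) * -(l * 1))) t :=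
      (((hasDerivAt_id t).const_mul l).neg.exp).const_mul C
    refine ⟨_, hd.sub hWd.hasDerivWithinAt, ?_⟩
    have h1 := (abs_le.1 hb).2
    have h2 : Real.exp (-(l * (t - τ))) = Real.exp (l * τ) * Real.exp (-(l * t)) := by
      rw [← Real.exp_add]; ring_nf
    rw [h2] at h1
    have hlt : (κ * a t * Real.exp (l * τ) + l) * (C * Real.exp (-(l * t))) < a t * y t := hlt
    nlinarith
  choose! u' hu' using hderu
  have hle : ∀ s ∈ Ioo r t₁, u s ≤ u r := fun s hs =>
    le_of_left_deriv_neg (u' := u') hs.1.le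
      (huc.mono fun x hx => by have := hx.1; show S ≤ x; linarith)
      (fun t ht => (hu' t ⟨hr1.trans ht.1, ht.2.trans_lt hs.2⟩).1)
      (fun t ht => (hu' t ⟨hr1.trans ht.1, ht.2.trans_lt hs.2⟩).2)
  have hut : ContinuousAt u t₁ := hyt.sub hWc.continuousAt
  have hfin : u t₁ ≤ u r :=
    le_of_tendsto (hut.tendsto.mono_left (nhdsWithin_le_nhds (s := Iio t₁)))
      (by filter_upwards [Ioo_mem_nhdsLT hr2] with s hs using hle s hs)
  have : 0 ≤ u t₁ := by simp only [hu]; linarith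
  linarith

/-- A Halanay-type criterion: a delay differential inequality whose delayed term is dominated by
a fraction `κ < 1` of the dissipation forces convergence to zero. -/
lemma tendsto_zero_of_delay_inequality {y a : ℝ → ℝ} {τ κ a₀ S : ℝ} (hτ : 0 < τ)
    (hκ1 : κ < 1) (ha : Continuous a) (ha₀ : 0 < a₀) (haa : ∀ t, a₀ ≤ a t)
    (hy : ContinuousOn y (Ici S))
    (hder : ∀ t > S + τ, ∀ᶠ s in nhdsWithin t (Iio t), ∃ d, HasDerivWithinAt y d (Iic s) s ∧
      ∀ M, (∀ r ∈ Icc (s - τ) s, |y r| ≤ M) → |d + a s * y s| ≤ κ * a s * M) :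
    Tendsto y atTop (nhds 0) := by
  obtain ⟨l, hl, hl0⟩ : ∃ l, l < a₀ * (1 - κ * Real.exp (l * τ)) ∧ 0 < l := by
    have h : ∀ᶠ l in nhds (0 : ℝ), l < a₀ * (1 - κ * Real.exp (l * τ)) := by
      refine ContinuousAt.eventually_lt continuousAt_id
        (Continuous.continuousAt (by fun_prop)) ?_
      simp only [zero_mul, Real.exp_zero, mul_one]
      exact mul_pos ha₀ (by linarith)
    exact ((h.filter_mono nhdsWithin_le_nhds).and
      (self_mem_nhdsWithin (s := Ioi (0 : ℝ)))).exists
  have hg : ContinuousOn (fun t => |y t| * Real.exp (l * t)) (Icc S (S + τ)) :=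
    ((hy.mono Icc_subset_Ici_self).abs).mul (Continuous.continuousOn (by fun_prop))
  obtain ⟨C₀, hC₀⟩ := isCompact_Icc.bddAbove_image hg
  set C := max C₀ 0 + 1 with hCdef
  have hC : 0 < C := by positivity
  have hinit : ∀ s ∈ Icc S (S + τ), |y s| < C * Real.exp (-(l * s)) := by
    intro s hs
    have h1 : |y s| * Real.exp (l * s) ≤ C₀ := hC₀ (mem_image_of_mem _ hs)
    have h2 : C₀ < C := by have := le_max_left C₀ 0; linarith
    rw [Real.exp_neg, ← div_eq_mul_inv, lt_div_iff₀ (Real.exp_pos _)]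
    linarith
  have hWc : Continuous fun t => C * Real.exp (-(l * t)) := by fun_prop
  have hall : ∀ t ∈ Ici S, |y t| < C * Real.exp (-(l * t)) := by
    by_contra! hcon
    set A := {t | t ∈ Ici S ∧ 0 ≤ |y t| - C * Real.exp (-(l * t))} with hA
    have hAc : IsClosed A :=
      (hy.abs.sub hWc.continuousOn).preimage_isClosed_of_isClosed isClosed_Ici isClosed_Ici
    have hAne : A.Nonempty := by
      obtain ⟨t, ht, h⟩ := hcon
      exact ⟨t, ht, by linarith⟩
    have hAb : BddBelow A := ⟨S, fun t ht => ht.1⟩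
    have hmem := hAc.csInf_mem hAne hAb
    set t₁ := sInf A
    have ht₁ : S + τ < t₁ := by
      by_contra! h
      have := hinit t₁ ⟨hmem.1, h⟩
      linarith [hmem.2]
    have hbef : ∀ s ∈ Ico S t₁, |y s| < C * Real.exp (-(l * s)) := by
      intro s hs
      by_contra! h
      exact absurd (csInf_le hAb (show s ∈ A from ⟨hs.1, by linarith⟩)) (not_le.2 hs.2)
    have h1 := lt_exp_barrier_of_lt_before hτ hC hl hl0 ha ha₀ haa (by linarith) hy
      (hder t₁ ht₁) hbef
    have h2 := lt_exp_barrier_of_lt_before (y := fun t => -y t) (t₁ := t₁) (S := S) hτ hC hl hl0 ha ha₀ haa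
      (by linarith) hy.neg (by
        filter_upwards [hder t₁ ht₁] with s ⟨d, hd, hdM⟩
        refine ⟨-d, hd.neg, fun M hM => ?_⟩
        have := hdM M (by simpa using hM)
        rwa [← abs_neg, show -(-d + a s * -y s) = d + a s * y s by ring])
      (by simpa using hbef)
    have := abs_lt.2 ⟨by linarith, h1⟩
    linarith [hmem.2]
  refine squeeze_zero_norm' (a := fun t => C * Real.exp (-(l * t))) ?_ ?_
  · filter_upwards [eventually_ge_atTop S] with t ht using (hall t ht).le
  · have h : Tendsto (fun t : ℝ => l * t) atTop atTop := tendsto_id.const_mul_atTop hl0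
    simpa using (Real.tendsto_exp_neg_atTop_nhds_zero.comp h).const_mul C

/-- `x ↦ exp (-x)` contracts distances to points `u ≥ u₀ > 0` by a uniform factor. -/
lemma abs_exp_neg_sub_exp_neg_le {u₀ u v : ℝ} (hu₀ : 0 < u₀) (hu : u₀ ≤ u) (hv : 0 ≤ v) :
    |Real.exp (-v) - Real.exp (-u)| ≤ (1 - Real.exp (-u₀)) / u₀ * |v - u| := by
  rcases eq_or_ne v u with rfl | hne
  · simp
  have hcx := convexOn_exp
  have h1 := hcx.secant_mono (a := -u) (x := -v) (y := 0) trivial trivial trivial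
    (fun h => hne (neg_injective h)) (by linarith) (by linarith)
  have h2 := hcx.secant_mono (a := 0) (x := -u) (y := -u₀) trivial trivial trivial
    (by linarith) (by linarith) (by linarith)
  have h3 : (Real.exp 0 - Real.exp (-u)) / (0 - -u) = (Real.exp (-u) - Real.exp 0) / (-u - 0) := by
    rw [← neg_div_neg_eq]; ring_nf
  have h4 : (Real.exp (-u₀) - Real.exp 0) / (-u₀ - 0) = (1 - Real.exp (-u₀)) / u₀ := by
    rw [← neg_div_neg_eq, Real.exp_zero]; ring_nf
  rw [h3] at h1
  rw [h4] at h2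
  have hd : 0 < |v - u| := abs_pos.2 (sub_ne_zero.2 hne)
  rw [← div_le_iff₀ hd, ← abs_div]
  have h5 : (Real.exp (-v) - Real.exp (-u)) / (v - u)
      = -((Real.exp (-v) - Real.exp (-u)) / (-v - -u)) := by
    rw [← div_neg]; ring_nf
  rw [h5, abs_neg, abs_of_nonneg]
  · exact h1.trans h2
  · rcases lt_or_gt_of_ne hne with h | h
    · exact div_nonneg (sub_nonneg.2 (Real.exp_le_exp.2 (by linarith))) (by linarith)
    · exact div_nonneg_of_nonpos (sub_nonpos.2 (Real.exp_le_exp.2 (by linarith))) (by linarith)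

lemma exists_pos_le_of_periodic {f : ℝ → ℝ} {ω : ℝ} (hω : ω ≠ 0) (hf : Continuous f)
    (hpos : ∀ t, 0 < f t) (hper : Function.Periodic f ω) : ∃ c > 0, ∀ t, c ≤ f t := by
  obtain ⟨c, ⟨s, rfl⟩, hc⟩ :=
    (hper.compact_of_continuous hω hf).exists_isLeast (range_nonempty f)
  exact ⟨f s, hpos s, fun t => hc (mem_range_self t)⟩

lemma exists_le_of_periodic {f : ℝ → ℝ} {ω : ℝ} (hω : ω ≠ 0) (hf : Continuous f)
    (hper : Function.Periodic f ω) : ∃ c, ∀ t, f t ≤ c := by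
  obtain ⟨c, ⟨s, rfl⟩, hc⟩ :=
    (hper.compact_of_continuous hω hf).exists_isGreatest (range_nonempty f)
  exact ⟨f s, fun t => hc (mem_range_self t)⟩

/-- A positive periodic solution is bounded away from zero. -/
lemma IsPosSolLW.exists_pos_le {n : ℕ} {a : ℝ → ℝ} {b β τi : Fin (n + 1) → ℝ → ℝ}
    {tk : ℕ → ℝ} {I : ℕ → ℝ → ℝ} {N : ℝ → ℝ} {ω : ℝ} (h : IsPosSolLW a b β τi tk I 0 N)
    (hω : 0 < ω) (hper : Function.Periodic N ω) (hI : ∀ k, ∀ u > (0 : ℝ), 0 < u + I k u) :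
    ∃ m > 0, ∀ t, m ≤ N t := by
  obtain ⟨-, -, hpos, hleft, -, hcont, -, -, hjump⟩ := h
  have hloc : ∀ s > 0, ∃ ε > 0, ∀ᶠ r in nhds s, ε ≤ N r := by
    intro s hs
    obtain ⟨L, hL, hLt⟩ : ∃ L > 0, Tendsto N (nhdsWithin s (Ioi s)) (nhds L) := by
      by_cases hk : ∃ k, s = tk k
      · obtain ⟨k, rfl⟩ := hk
        exact ⟨_, hI k _ (hpos _ hs), hjump k hs⟩
      · push Not at hk
        exact ⟨_, hpos s hs, (hcont s hs hk).tendsto.mono_left nhdsWithin_le_nhds⟩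
    have hN := hpos s hs
    refine ⟨min (N s / 2) (L / 2), by positivity, ?_⟩
    rw [← nhdsLE_sup_nhdsGT, eventually_sup]
    constructor
    · filter_upwards [(hleft s hs).eventually_const_lt (half_lt_self hN)] with r hr
      exact (min_le_left _ _).trans hr.le
    · filter_upwards [hLt.eventually_const_lt (half_lt_self hL)] with r hr
      exact (min_le_right _ _).trans hr.le
  obtain ⟨m, hm, hmle⟩ : ∃ m > 0, ∀ t ∈ Icc ω (ω + ω), m ≤ N t := by
    refine (isCompact_Icc (a := ω) (b := ω + ω)).induction_on
      (p := fun S => ∃ m > 0, ∀ t ∈ S, m ≤ N t) ⟨1, one_pos, by simp⟩ ?_ ?_ ?_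
    · rintro S T hST ⟨m, hm, h⟩
      exact ⟨m, hm, fun t ht => h t (hST ht)⟩
    · rintro S T ⟨m, hm, h⟩ ⟨m', hm', h'⟩
      refine ⟨min m m', lt_min hm hm', ?_⟩
      rintro t (ht | ht)
      · exact (min_le_left _ _).trans (h t ht)
      · exact (min_le_right _ _).trans (h' t ht)
    · intro s hs
      obtain ⟨ε, hε, hev⟩ := hloc s (hω.trans_le hs.1)
      exact ⟨_, mem_nhdsWithin_of_mem_nhds hev, ε, hε, fun t ht => ht⟩
  refine ⟨m, hm, fun t => ?_⟩
  obtain ⟨s, hs, hts⟩ := hper.exists_mem_Ico hω t ω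
  rw [hts]
  exact hmle s ⟨hs.1, hs.2.le⟩

lemma exists_card_lt_of_periodic {tk : ℕ → ℝ} {ω : ℝ} {p : ℕ} (hω : 0 < ω)
    (hmono : StrictMono tk) (hper : ∀ k, tk (k + p) = tk k + ω) (t : ℝ) :
    ∃ q : ℕ, ∀ k, tk k < t ↔ k < q := by
  have hmul : ∀ m : ℕ, tk (m * p) = tk 0 + m * ω := by
    intro m
    induction m with
    | zero => simp
    | succ m ih => rw [Nat.succ_mul, hper, ih]; push_cast; ring
  have hex : ∃ k, t ≤ tk k := by
    obtain ⟨m, hm⟩ := exists_nat_ge ((t - tk 0) / ω)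
    refine ⟨m * p, ?_⟩
    rw [hmul]
    rw [div_le_iff₀ hω] at hm
    linarith
  classical
  refine ⟨Nat.find hex, fun k => ⟨fun h => ?_, fun h => not_le.1 (Nat.find_min hex h)⟩⟩
  by_contra! hk
  exact absurd ((Nat.find_spec hex).trans (hmono.monotone hk)) (not_le.2 h)

lemma exists_prod_range_le_of_periodic {f : ℕ → ℝ} {p : ℕ} (hp : 0 < p) (hf : ∀ k, 0 < f k)
    (hper : ∀ k, f (k + p) = f k) (h1 : ∏ k ∈ Finset.range p, f k ≤ 1) :
    ∃ C, ∀ q, ∏ k ∈ Finset.range q, f k ≤ C := by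
  refine ⟨∑ j ∈ Finset.range p, ∏ k ∈ Finset.range j, f k, fun q => ?_⟩
  induction q using Nat.strong_induction_on with
  | _ q ih =>
    rcases lt_or_ge q p with hq | hq
    · exact Finset.single_le_sum (f := fun j => ∏ k ∈ Finset.range j, f k)
        (fun j _ => Finset.prod_nonneg fun k _ => (hf k).le) (Finset.mem_range.2 hq)
    · obtain ⟨r, rfl⟩ := Nat.exists_eq_add_of_le hq
      rw [Finset.prod_range_add]
      simp only [add_comm p, hper]
      refine le_trans ?_ (ih r (by omega))
      exact mul_le_of_le_one_left (Finset.prod_nonneg fun k _ => (hf k).le) h1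

/-- The counting function of impulse times `< t` is left-continuous. -/
lemma eventually_card_eq_left {tk : ℕ → ℝ} {q : ℝ → ℕ} (hq : ∀ t k, tk k < t ↔ k < q t) (t : ℝ) :
    ∀ᶠ s in nhdsWithin t (Iic t), q s = q t := by
  have h : ∀ᶠ s in nhdsWithin t (Iic t), ∀ k ∈ Finset.range (q t), tk k < s :=
    (Finset.eventually_all _).2 fun k hk =>
      (eventually_gt_nhds ((hq t k).2 (Finset.mem_range.1 hk))).filter_mono nhdsWithin_le_nhds
  filter_upwards [h, self_mem_nhdsWithin] with s hs hst
  have hst : s ≤ t := hst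
  refine eq_of_forall_lt_iff fun k => ?_
  exact ⟨fun hk => (hq t k).1 (((hq s k).2 hk).trans_le hst),
    fun hk => (hq s k).1 (hs k (Finset.mem_range.2 hk))⟩

lemma eventually_card_eq_right {tk : ℕ → ℝ} {q : ℝ → ℕ} (hq : ∀ t k, tk k < t ↔ k < q t) {t : ℝ}
    (ht : ∀ k, t ≠ tk k) : ∀ᶠ s in nhdsWithin t (Ioi t), q s = q t := by
  have h1 : t < tk (q t) :=
    lt_of_le_of_ne (not_lt.1 fun h => lt_irrefl _ ((hq t _).1 h)) (ht _)
  filter_upwards [(eventually_lt_nhds h1).filter_mono nhdsWithin_le_nhds,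
    self_mem_nhdsWithin] with s hs hst
  have hst : t < s := hst
  refine le_antisymm (not_lt.1 fun h => ?_) (not_lt.1 fun h => ?_)
  · exact lt_asymm hs ((hq s _).2 h)
  · exact lt_irrefl _ ((hq s _).1 (((hq t _).2 h).trans hst))

lemma eventually_card_eq_right_of_eq {tk : ℕ → ℝ} {q : ℝ → ℕ} (hmono : StrictMono tk)
    (hq : ∀ t k, tk k < t ↔ k < q t) (j : ℕ) :
    ∀ᶠ s in nhdsWithin (tk j) (Ioi (tk j)), q s = j + 1 := by
  filter_upwards [(eventually_lt_nhds (hmono j.lt_succ_self)).filter_mono nhdsWithin_le_nhds,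
    self_mem_nhdsWithin] with s hs hst
  refine le_antisymm (not_lt.1 fun h => ?_) ((hq s j).1 hst)
  exact lt_asymm hs ((hq s _).2 h)

lemma card_apply_eq {tk : ℕ → ℝ} {q : ℝ → ℕ} (hmono : StrictMono tk)
    (hq : ∀ t k, tk k < t ↔ k < q t) (j : ℕ) : q (tk j) = j :=
  eq_of_forall_lt_iff fun k => by rw [← hq, hmono.lt_iff_lt]

/-- Each product of factors `(1 + b_k)⁻¹` over the impulses in `[t - τ t, t)` is at most
`BfunLW`. -/
lemma prod_Ico_le_BfunLW {tk bb : ℕ → ℝ} {q : ℝ → ℕ} (hq : ∀ t k, tk k < t ↔ k < q t)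
    {τ : ℝ → ℝ} {t : ℝ} (hτ : 0 ≤ τ t) :
    ∏ k ∈ Finset.Ico (q (t - τ t)) (q t), (1 + bb k)⁻¹ ≤ BfunLW tk bb τ t := by
  have hval : ∀ θ, ∏ᶠ k ∈ {k : ℕ | t + θ ≤ tk k ∧ tk k < t}, (1 + bb k)⁻¹
      = ∏ k ∈ Finset.Ico (q (t + θ)) (q t), (1 + bb k)⁻¹ := by
    intro θ
    have hset : {k : ℕ | t + θ ≤ tk k ∧ tk k < t} = ↑(Finset.Ico (q (t + θ)) (q t)) := by
      ext k
      rw [mem_ofPred_eq, Finset.coe_Ico, mem_Ico, hq, ← not_lt, hq, not_lt]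
    rw [hset, finprod_mem_coe_finset]
  refine le_csSup ?_ ⟨-τ t, ⟨le_rfl, by linarith⟩, ?_⟩
  · refine (((Set.finite_Iic (q t)).image
      fun j => ∏ k ∈ Finset.Ico j (q t), (1 + bb k)⁻¹).bddAbove).mono ?_
    rintro _ ⟨θ, hθ, rfl⟩
    refine ⟨q (t + θ), ?_, (hval θ).symm⟩
    show q (t + θ) ≤ q t
    refine not_lt.1 fun h => ?_
    have h1 := (hq (t + θ) _).2 h
    exact lt_irrefl _ ((hq t _).1 (h1.trans_le (by linarith [hθ.2])))
  · simp only [hval, sub_eq_add_neg]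

/-- Dividing by the accumulated jump factors removes the discontinuities of a function with
jumps `x (t_k⁺) = (1 + c_k) x (t_k)`. -/
lemma continuousAt_div_prod_jumps {x : ℝ → ℝ} {tk c : ℕ → ℝ} {q : ℝ → ℕ} (hmono : StrictMono tk)
    (hq : ∀ t k, tk k < t ↔ k < q t) (hc : ∀ k, 0 < 1 + c k) {t : ℝ}
    (hleft : ContinuousWithinAt x (Iic t) t) (hcont : (∀ k, t ≠ tk k) → ContinuousAt x t)
    (hjump : ∀ k, t = tk k → Tendsto x (nhdsWithin t (Ioi t)) (nhds ((1 + c k) * x t))) :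
    ContinuousAt (fun t => x t / ∏ k ∈ Finset.range (q t), (1 + c k)) t := by
  rw [ContinuousAt, ← nhdsLE_sup_nhdsGT]
  refine tendsto_sup.2 ⟨?_, ?_⟩
  · refine (hleft.tendsto.div_const (∏ k ∈ Finset.range (q t), (1 + c k))).congr' ?_
    filter_upwards [eventually_card_eq_left hq t] with s hs
    rw [hs]
  · by_cases hk : ∃ k, t = tk k
    · obtain ⟨k, rfl⟩ := hk
      have h := (hjump k rfl).div_const (∏ j ∈ Finset.range (k + 1), (1 + c j))
      have hval : (1 + c k) * x (tk k) / ∏ j ∈ Finset.range (k + 1), (1 + c j)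
          = x (tk k) / ∏ j ∈ Finset.range (q (tk k)), (1 + c j) := by
        rw [card_apply_eq hmono hq, Finset.prod_range_succ, mul_comm (∏ j ∈ _, _),
          mul_div_mul_left _ _ (hc k).ne']
      rw [hval] at h
      refine h.congr' ?_
      filter_upwards [eventually_card_eq_right_of_eq hmono hq k] with s hs
      rw [hs]
    · push Not at hk
      refine (((hcont hk).tendsto.mono_left nhdsWithin_le_nhds).div_const
        (∏ k ∈ Finset.range (q t), (1 + c k))).congr' ?_
      filter_upwards [eventually_card_eq_right hq hk] with s hs
      rw [hs]

theorem theorem32_LW_attractive {n : ℕ}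
    (ω : ℝ) (hω : 0 < ω) (p : ℕ) (hp : 0 < p)
    (a : ℝ → ℝ) (b β τi : Fin (n + 1) → ℝ → ℝ) (tk : ℕ → ℝ) (I : ℕ → ℝ → ℝ)
    -- (f₀)
    (ha : Continuous a ∧ (∀ t, 0 < a t) ∧ Function.Periodic a ω)
    (hb : ∀ i, Continuous (b i) ∧ (∀ t, 0 < b i t) ∧ Function.Periodic (b i) ω)
    (hβ : ∀ i, Continuous (β i) ∧ (∀ t, 0 < β i t) ∧ Function.Periodic (β i) ω)
    (hτ : ∀ i, Continuous (τi i) ∧ (∀ t, 0 < τi i t) ∧ Function.Periodic (τi i) ω)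
    -- (i₀)
    (htk_mono : StrictMono tk) (htk0 : ∀ k < p, 0 < tk k ∧ tk k < ω)
    (htk_per : ∀ k, tk (k + p) = tk k + ω)
    (hI_cont : ∀ k, ContinuousOn (I k) (Set.Ici 0))
    (hI_pos : ∀ k, ∀ u > (0:ℝ), 0 < u + I k u)
    (hI_per : ∀ k, I (k + p) = I k)
    -- (i₁), with (a_k), (b_k) extended p-periodically
    (aa bb : ℕ → ℝ) (haa_per : ∀ k, aa (k + p) = aa k) (hbb_per : ∀ k, bb (k + p) = bb k)
    (hbb : ∀ k, -1 < bb k)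
    (hi1 : ∀ k, ∀ x y : ℝ, 0 ≤ x → 0 ≤ y → x ≠ y →
      bb k ≤ (I k x - I k y) / (x - y) ∧ (I k x - I k y) / (x - y) ≤ aa k)
    -- (i₂)
    (hi2 : ∏ k ∈ Finset.range p, (1 + aa k) ≤ 1)
    -- the positive ω-periodic solution
    (Nstar : ℝ → ℝ) (hNstar : IsPosSolLW a b β τi tk I 0 Nstar)
    (hNper : ∀ t, Nstar (t + ω) = Nstar t)
    -- condition (3.5)
    (hcond : ∀ t ≥ (0:ℝ),
      (∑ i, β i t * b i t * BfunLW tk bb (τi i) t) ≤ a t) :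
    -- N* is globally attractive
    ∀ N : ℝ → ℝ, IsPosSolLW a b β τi tk I 0 N →
      Tendsto (fun t => N t - Nstar t) atTop (nhds 0) := by
  intro N hN
  have hω' := hω.ne'
  obtain ⟨ha_cont, ha_pos, ha_per⟩ := ha
  obtain ⟨a₀, ha₀, ha₀_le⟩ := exists_pos_le_of_periodic hω' ha_cont ha_pos ha_per
  obtain ⟨m, hm, hm_le⟩ := hNstar.exists_pos_le hω hNper hI_pos
  have hβlow : ∀ i, ∃ c > 0, ∀ t, c ≤ β i t := fun i =>
    exists_pos_le_of_periodic hω' (hβ i).1 (hβ i).2.1 (hβ i).2.2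
  choose βlow hβlow_pos hβlow_le using hβlow
  have hτup : ∀ i, ∃ c, ∀ t, τi i t ≤ c := fun i =>
    exists_le_of_periodic hω' (hτ i).1 (hτ i).2.2
  choose τup hτup_le using hτup
  obtain ⟨τ, hτ_le⟩ : ∃ τ, ∀ i t, τi i t ≤ τ := by
    obtain ⟨τ, h⟩ := (Set.finite_range τup).bddAbove
    exact ⟨τ, fun i t => (hτup_le i t).trans (h (mem_range_self i))⟩
  have hτ_pos : 0 < τ := ((hτ 0).2.1 0).trans_le (hτ_le 0 0)
  obtain ⟨β₀, hβ₀, hβ₀_le⟩ : ∃ β₀ > 0, ∀ i t, β₀ ≤ β i t := by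
    refine ⟨Finset.univ.inf' Finset.univ_nonempty βlow, ?_, fun i t => ?_⟩
    · exact (Finset.lt_inf'_iff _).2 fun i _ => hβlow_pos i
    · exact (Finset.inf'_le _ (Finset.mem_univ i)).trans (hβlow_le i t)
  set u₀ := β₀ * m with hu₀_def
  have hu₀ : 0 < u₀ := mul_pos hβ₀ hm
  set κ := (1 - Real.exp (-u₀)) / u₀ with hκ_def
  have hκ : 0 ≤ κ :=
    div_nonneg (sub_nonneg.2 (Real.exp_le_one_iff.2 (by linarith))) hu₀.le
  have hκ1 : κ < 1 := by
    rw [hκ_def, div_lt_one hu₀]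
    have := Real.add_one_lt_exp (x := -u₀) (by linarith)
    linarith
  choose q hq using exists_card_lt_of_periodic hω htk_mono htk_per
  have htk_pos : ∀ k, 0 < tk k := fun k =>
    (htk0 0 hp).1.trans_le (htk_mono.monotone (Nat.zero_le k))
  have hab : ∀ k, bb k ≤ aa k := fun k =>
    (hi1 k 0 1 le_rfl zero_le_one zero_ne_one).1.trans
      (hi1 k 0 1 le_rfl zero_le_one zero_ne_one).2
  obtain ⟨-, -, hN_pos, hN_left, -, hN_cont, hN_diff, hN_eq, hN_jump⟩ := hN
  obtain ⟨-, -, hS_pos, hS_left, -, hS_cont, hS_diff, hS_eq, hS_jump⟩ := hNstar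
  have hjump : ∀ k, ∃ c, bb k ≤ c ∧ c ≤ aa k ∧ (1 + c) * (N (tk k) - Nstar (tk k)) =
      N (tk k) + I k (N (tk k)) - (Nstar (tk k) + I k (Nstar (tk k))) := by
    intro k
    rcases eq_or_ne (N (tk k)) (Nstar (tk k)) with h | h
    · exact ⟨bb k, le_rfl, hab k, by rw [h]; ring⟩
    · obtain ⟨h1, h2⟩ := hi1 k _ _ (hN_pos _ (htk_pos k)).le (hS_pos _ (htk_pos k)).le h
      refine ⟨_, h1, h2, ?_⟩
      have := sub_ne_zero.2 h
      field_simp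
      ring
  choose c hbc hca hc_jump using hjump
  have hc : ∀ k, 0 < 1 + c k := fun k => by linarith [hbb k, hbc k]
  set Q : ℝ → ℝ := fun t => ∏ k ∈ Finset.range (q t), (1 + c k) with hQ_def
  have hQ : ∀ t, 0 < Q t := fun t => Finset.prod_pos fun k _ => hc k
  set y : ℝ → ℝ := fun t => (N t - Nstar t) / Q t with hy_def
  have hy_cont : ∀ t > 0, ContinuousAt y t := by
    intro t ht
    refine continuousAt_div_prod_jumps (x := fun t => N t - Nstar t) htk_mono hq hc
      ((hN_left t ht).sub (hS_left t ht)) (fun h => (hN_cont t ht h).sub (hS_cont t ht h)) ?_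
    rintro k rfl
    simp only [hc_jump]
    exact (hN_jump k ht).sub (hS_jump k ht)
  have hQ_ratio : ∀ s i, Q (s - τi i s) / Q s ≤ BfunLW tk bb (τi i) s := by
    intro s i
    have hτs := (hτ i).2.1 s
    refine le_trans ?_ (prod_Ico_le_BfunLW hq hτs.le)
    have hle : q (s - τi i s) ≤ q s :=
      not_lt.1 fun h => lt_irrefl _ ((hq s _).1 (((hq _ _).2 h).trans (by linarith)))
    have hsplit := Finset.prod_range_mul_prod_Ico (fun k => 1 + c k) hle
    have hQs : Q s = Q (s - τi i s) * ∏ k ∈ Finset.Ico (q (s - τi i s)) (q s), (1 + c k) :=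
      hsplit.symm
    rw [hQs, div_mul_cancel_left₀ (hQ _).ne', ← Finset.prod_inv_distrib]
    refine Finset.prod_le_prod (fun k _ => (inv_pos.2 (hc k)).le) fun k _ => ?_
    exact inv_anti₀ (by linarith [hbb k]) (by linarith [hbc k])
  have hder : ∀ s > 1 + τ, (∀ k, s ≠ tk k) → ∃ d, HasDerivWithinAt y d (Iic s) s ∧
      ∀ M, (∀ r ∈ Icc (s - τ) s, |y r| ≤ M) → |d + a s * y s| ≤ κ * a s * M := by
    intro s hs hsk
    have hs0 : 0 < s := by linarith
    refine ⟨(derivWithin N (Iic s) s - derivWithin Nstar (Iic s) s) / Q s, ?_, fun M hM => ?_⟩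
    · refine (((hN_diff s hs0).hasDerivWithinAt.sub
        (hS_diff s hs0).hasDerivWithinAt).div_const (Q s)).congr_of_eventuallyEq ?_ rfl
      filter_upwards [eventually_card_eq_left hq s] with r hr
      simp only [hy_def, hQ_def, hr, Pi.sub_apply]
    have hM0 : 0 ≤ M := (abs_nonneg _).trans (hM s ⟨by linarith, le_rfl⟩)
    have hrepr : (derivWithin N (Iic s) s - derivWithin Nstar (Iic s) s) / Q s + a s * y s
        = ∑ i, b i s * (Real.exp (-(β i s * N (s - τi i s)))
            - Real.exp (-(β i s * Nstar (s - τi i s)))) / Q s := by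
      simp only [mul_sub]
      rw [← Finset.sum_div, Finset.sum_sub_distrib, ← hN_eq s hs0 hsk, ← hS_eq s hs0 hsk]
      simp only [hy_def]
      ring
    have hterm : ∀ i, |b i s * (Real.exp (-(β i s * N (s - τi i s)))
            - Real.exp (-(β i s * Nstar (s - τi i s)))) / Q s|
        ≤ κ * (β i s * b i s * BfunLW tk bb (τi i) s) * M := by
      intro i
      set r := s - τi i s with hr
      have hτs := (hτ i).2.1 s
      have hτs' := hτ_le i s
      have hr0 : 0 < r := by linarith
      have hbs := (hb i).2.1 s
      have hβs := (hβ i).2.1 s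
      have hexp := abs_exp_neg_sub_exp_neg_le hu₀
        (mul_le_mul (hβ₀_le i s) (hm_le r) hm.le hβs.le)
        (mul_nonneg hβs.le (hN_pos r hr0).le)
      rw [← mul_sub, abs_mul, abs_of_pos hβs] at hexp
      have hx : |N r - Nstar r| = |y r| * Q r := by
        simp only [hy_def]
        rw [abs_div, abs_of_pos (hQ r), div_mul_cancel₀ _ (hQ r).ne']
      rw [hx] at hexp
      rw [abs_div, abs_mul, abs_of_pos hbs, abs_of_pos (hQ s)]
      calc _ ≤ b i s * (κ * (β i s * (|y r| * Q r))) / Q s := by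
            have := hQ s
            gcongr
        _ = κ * (β i s * b i s * (Q r / Q s)) * |y r| := by ring
        _ ≤ _ := by
            have := hM r ⟨by linarith, by linarith⟩
            have h2 := hQ_ratio s i
            have h3 : 0 ≤ Q r / Q s := div_nonneg (hQ r).le (hQ s).le
            have h4 := h3.trans h2
            gcongr
    rw [hrepr]
    calc _ ≤ ∑ i, κ * (β i s * b i s * BfunLW tk bb (τi i) s) * M :=
          (Finset.abs_sum_le_sum_abs _ _).trans (Finset.sum_le_sum fun i _ => hterm i)
      _ = κ * (∑ i, β i s * b i s * BfunLW tk bb (τi i) s) * M := by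
          rw [Finset.mul_sum, Finset.sum_mul]
      _ ≤ κ * a s * M := by
          have := hcond s hs0.le
          gcongr
  have hy_lim : Tendsto y atTop (nhds 0) := by
    refine tendsto_zero_of_delay_inequality (S := 1) hτ_pos hκ1 ha_cont ha₀ ha₀_le
      (fun t ht => (hy_cont t (one_pos.trans_le ht)).continuousWithinAt) fun t ht => ?_
    filter_upwards [(eventually_card_eq_left hq t).filter_mono
      (nhdsWithin_mono t Iio_subset_Iic_self), self_mem_nhdsWithin,
      (eventually_gt_nhds ht).filter_mono nhdsWithin_le_nhds] with s hs hst hs1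
    refine hder s hs1 ?_
    rintro k rfl
    have h1 := (hq t k).1 hst
    rw [← hs, ← hq] at h1
    exact lt_irrefl _ h1
  obtain ⟨C, hC⟩ := exists_prod_range_le_of_periodic (f := fun k => 1 + aa k) hp
    (fun k => by linarith [hbb k, hab k]) (fun k => by rw [haa_per]) hi2
  have hQC : ∀ t, Q t ≤ C := fun t =>
    (Finset.prod_le_prod (fun k _ => (hc k).le) fun k _ => by linarith [hca k]).trans (hC (q t))
  refine squeeze_zero_norm (a := fun t => |y t| * C) (fun t => ?_)
    (by simpa using hy_lim.abs.mul_const C)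
  have hx : N t - Nstar t = y t * Q t := by
    simp only [hy_def]
    rw [div_mul_cancel₀ _ (hQ t).ne']
  rw [hx, Real.norm_eq_abs, abs_mul, abs_of_pos (hQ t)]
  exact mul_le_mul_of_nonneg_left (hQC t) (abs_nonneg _)
end
end

section
/- Consider the impulsive Lasota–Wazewska equation (LW) with constant delays τ_i(t) ≡ m_i·ω, where m_i are positive integers, and set m̄ := max_{1≤i≤n} m_i. Assume (f₀), (i₀), (i₁), (i₂) with I_k(0) = 0 for all k, and let N* be a positive ω-periodic solution of (LW). If B^{m̄} · ( β̄ · N̄* · (e^{(βN*)‾} − 1) )^{1/2} · (1 − e^{−m̄·∫₀^ω a(u)du}) · [ 1 − (1 − e^{−∫₀^ω a(u)du})⁻¹ · Σ_{k=1}^p min(b_k, 0) ] < 1, where B := max_{1≤l,j≤p} ∏_{k=1}^j (1 + b_{l+k})⁻¹, then N* attracts every positive solution of (LW): every positive solution N on [0,∞) satisfies N(t) − N*(t) → 0 as t → ∞. -/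
open Filter Set

noncomputable section

/-- `B = max_{1 ≤ l,j ≤ p} ∏_{k=1}^j (1 + b_{l+k})⁻¹` (here `bb 0` plays the role of `b_1`). -/
def Bconst (p : ℕ) (hp : 0 < p) (bb : ℕ → ℝ) : ℝ :=
  ((Finset.Icc 1 p) ×ˢ (Finset.Icc 1 p)).sup'
    ((Finset.nonempty_Icc.mpr hp).product (Finset.nonempty_Icc.mpr hp))
    (fun lj => ∏ k ∈ Finset.range lj.2, (1 + bb (lj.1 + k))⁻¹)

open Topology

/-- A function whose left difference quotients are asymptotically nonpositive and which never
jumps upwards is nonincreasing. -/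
theorem le_of_left_slope_nonpos {G : ℝ → ℝ} {s t : ℝ} (hst : s ≤ t)
    (hl : ∀ r ∈ Ioc s t, ∀ ε > 0, ∀ᶠ r' in 𝓝[<] r, G r ≤ G r' + ε * (r - r'))
    (hr : ∀ r ∈ Ico s t, ∀ ε > 0, ∀ᶠ r' in 𝓝[>] r, G r' ≤ G r + ε) : G t ≤ G s := by
  have key : ∀ ε > 0, G t ≤ G s + ε * (t - s) := by
    intro ε hε
    set S : Set ℝ := {r | r ∈ Icc s t ∧ G t ≤ G r + ε * (t - r)} with hS
    have hne : S.Nonempty := ⟨t, ⟨hst, le_rfl⟩, by simp⟩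
    have hbd : BddBelow S := ⟨s, fun r hr => hr.1.1⟩
    set r₀ := sInf S with hr₀
    have hsr : s ≤ r₀ := le_csInf hne fun r hr => hr.1.1
    have hrt : r₀ ≤ t := csInf_le hbd ⟨⟨hst, le_rfl⟩, by simp⟩
    have hmem : r₀ ∈ S := by
      by_contra hnot
      have hlt : r₀ < t := by
        rcases hrt.lt_or_eq with h | h
        · exact h
        · exact absurd (h ▸ ⟨⟨hst, le_rfl⟩, by simp⟩ : r₀ ∈ S) hnot
      refine hnot ⟨⟨hsr, hrt⟩, le_of_forall_pos_le_add fun η hη => ?_⟩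
      obtain ⟨u, hu, hu'⟩ := mem_nhdsGT_iff_exists_Ioo_subset.1 (hr r₀ ⟨hsr, hlt⟩ η hη)
      obtain ⟨q, hqS, hqu⟩ := exists_lt_of_csInf_lt hne (show sInf S < u from hu)
      have hq0 : r₀ ≤ q := csInf_le hbd hqS
      have hq1 : r₀ < q := lt_of_le_of_ne hq0 fun h => hnot (h ▸ hqS)
      have h1 : G q ≤ G r₀ + η := hu' ⟨hq1, hqu⟩
      have h2 := hqS.2
      nlinarith
    rcases hsr.lt_or_eq with h | h
    · exfalso
      obtain ⟨u, hu, hu'⟩ :=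
        mem_nhdsLT_iff_exists_Ioo_subset.1 (hl r₀ ⟨h, hrt⟩ ε hε)
      have hu2 : u < r₀ := hu
      obtain ⟨q, hq1, hq2⟩ := exists_between (max_lt h hu2)
      have h1 : G r₀ ≤ G q + ε * (r₀ - q) := hu' ⟨(le_max_right _ _).trans_lt hq1, hq2⟩
      have hq : q ∈ S := ⟨⟨((le_max_left _ _).trans_lt hq1).le, hq2.le.trans hrt⟩, by
        have := hmem.2; linarith⟩
      exact absurd (csInf_le hbd hq) (not_le.2 hq2)
    · rw [h]; exact hmem.2
  refine le_of_forall_pos_le_add fun η hη => ?_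
  have h := key (η / (t - s + 1)) (by have : 0 ≤ t - s := sub_nonneg.2 hst; positivity)
  have h2 : η / (t - s + 1) * (t - s) ≤ η := by
    have : 0 ≤ t - s := sub_nonneg.2 hst
    rw [div_mul_eq_mul_div, div_le_iff₀ (by positivity)]
    nlinarith
  linarith

theorem eventually_le_of_left_deriv_nonpos {G : ℝ → ℝ} {r d : ℝ} (hd : d ≤ 0)
    (h : HasDerivWithinAt G d (Iic r) r) {ε : ℝ} (hε : 0 < ε) :
    ∀ᶠ r' in 𝓝[<] r, G r ≤ G r' + ε * (r - r') := by
  have h1 := hasDerivWithinAt_iff_tendsto_slope.1 h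
  have h2 : Iic r \ {r} = Iio r := by
    ext x; simp [lt_iff_le_and_ne]
  rw [h2] at h1
  filter_upwards [h1.eventually (gt_mem_nhds (lt_of_le_of_lt hd hε)), self_mem_nhdsWithin]
    with q hq hqr
  have hqr' : q < r := hqr
  rw [slope_def_field, div_lt_iff_of_neg (by linarith)] at hq
  nlinarith

/-- Monotonicity from left derivatives, for functions with isolated downward jumps at `tk k`. -/
theorem le_of_left_deriv_nonpos {G : ℝ → ℝ} {tk : ℕ → ℝ} {s t : ℝ} (hst : s ≤ t)
    (hiso : ∀ r, ∀ᶠ r' in 𝓝[<] r, ∀ k, r' ≠ tk k)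
    (hd : ∀ r ∈ Ioc s t, (∀ k, r ≠ tk k) → ∃ d ≤ 0, HasDerivWithinAt G d (Iic r) r)
    (hc : ∀ r ∈ Ioc s t, ContinuousWithinAt G (Iic r) r)
    (hr : ∀ r ∈ Ico s t, ∃ L ≤ G r, Tendsto G (𝓝[>] r) (𝓝 L)) : G t ≤ G s := by
  have hr' : ∀ r ∈ Ico s t, ∀ ε > 0, ∀ᶠ r' in 𝓝[>] r, G r' ≤ G r + ε := by
    intro r hrm ε hε
    obtain ⟨L, hL, hT⟩ := hr r hrm
    filter_upwards [hT.eventually (gt_mem_nhds (show L < G r + ε by linarith))] with q hq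
    exact hq.le
  refine le_of_left_slope_nonpos hst (fun r hrm ε hε => ?_) hr'
  by_cases hk : ∀ k, r ≠ tk k
  · obtain ⟨d, hd0, hd1⟩ := hd r hrm hk
    exact eventually_le_of_left_deriv_nonpos hd0 hd1 hε
  · obtain ⟨u, hu, hu'⟩ := mem_nhdsLT_iff_exists_Ioo_subset.1 (hiso r)
    have hu2 : u < r := hu
    filter_upwards [Ioo_mem_nhdsLT (max_lt hrm.1 hu2)] with q hq
    have hsq : s < q := (le_max_left _ _).trans_lt hq.1
    have huq : u < q := (le_max_right _ _).trans_lt hq.1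
    have hle : ∀ᶠ w in 𝓝[<] r, G w ≤ G q := by
      filter_upwards [Ioo_mem_nhdsLT hq.2] with w hw
      refine le_of_left_slope_nonpos hw.1.le (fun x hx ε hε => ?_)
        (fun x hx => hr' x ⟨hsq.le.trans hx.1, hx.2.trans (hw.2.trans_le hrm.2)⟩)
      obtain ⟨d, hd0, hd1⟩ := hd x ⟨hsq.trans hx.1, hx.2.trans (hw.2.le.trans hrm.2)⟩
        (hu' ⟨huq.trans hx.1, hx.2.trans_lt hw.2⟩)
      exact eventually_le_of_left_deriv_nonpos hd0 hd1 hε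
    have hlim : Tendsto G (𝓝[<] r) (𝓝 (G r)) :=
      (hc r hrm).mono_left (nhdsWithin_mono _ Iio_subset_Iic_self)
    have := le_of_tendsto hlim hle
    have h3 : 0 ≤ ε * (r - q) := mul_nonneg hε.le (by linarith [hq.2])
    linarith

/-- Periodic impulse times, a periodic decay rate, and periodic jump factors `α k`. -/
structure ImpulseData (ω : ℝ) (p : ℕ) (a : ℝ → ℝ) (tk : ℕ → ℝ) (α : ℕ → ℝ) : Prop where
  ω_pos : 0 < ω
  a_cont : Continuous a
  a_per : Function.Periodic a ω
  a_pos : ∀ t, 0 < a t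
  tk_mono : StrictMono tk
  tk_mem : ∀ k < p, 0 < tk k ∧ tk k < ω
  tk_per : ∀ k, tk (k + p) = tk k + ω
  α_pos : ∀ k, 0 < α k
  α_per : ∀ k, α (k + p) = α k

/-- The number of impulse times strictly before `t`. -/
def impulseCount (tk : ℕ → ℝ) (t : ℝ) : ℕ := sInf {k | t ≤ tk k}

/-- The inverse of the decay factor at rate `a`. -/
def growthFactor (a : ℝ → ℝ) (t : ℝ) : ℝ := Real.exp (∫ u in (0:ℝ)..t, a u)

/-- The product of the jump factors at the impulse times strictly before `t`. -/
def jumpProd (tk : ℕ → ℝ) (α : ℕ → ℝ) (t : ℝ) : ℝ :=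
  ∏ k ∈ Finset.range (impulseCount tk t), α k

/-- `y` divided by the solution of the linear impulsive equation with jump factors `α`. -/
def normalized (a : ℝ → ℝ) (tk : ℕ → ℝ) (α : ℕ → ℝ) (y : ℝ → ℝ) (t : ℝ) : ℝ :=
  y t * (growthFactor a t / jumpProd tk α t)

namespace ImpulseData

variable {ω : ℝ} {p : ℕ} {a : ℝ → ℝ} {tk α : ℕ → ℝ}

theorem tk_add_mul (D : ImpulseData ω p a tk α) (k j : ℕ) :
    tk (k + j * p) = tk k + j * ω := by
  induction j with
  | zero => simp
  | succ j ih =>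
    rw [Nat.succ_mul, ← add_assoc, D.tk_per, ih]; push_cast; ring

theorem exists_le_tk (D : ImpulseData ω p a tk α) (t : ℝ) : {k | t ≤ tk k}.Nonempty := by
  obtain ⟨j, hj⟩ := exists_nat_gt ((t - tk 0) / ω)
  refine ⟨0 + j * p, ?_⟩
  rw [div_lt_iff₀ D.ω_pos] at hj
  simp only [mem_ofPred_eq, D.tk_add_mul]
  linarith

theorem le_tk_count (D : ImpulseData ω p a tk α) (t : ℝ) : t ≤ tk (impulseCount tk t) :=
  Nat.sInf_mem (D.exists_le_tk t)

theorem lt_count (D : ImpulseData ω p a tk α) {t : ℝ} {k : ℕ} :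
    k < impulseCount tk t ↔ tk k < t := by
  constructor
  · intro h
    by_contra hn
    exact absurd (Nat.sInf_le (show k ∈ {k | t ≤ tk k} from not_lt.1 hn)) (not_le.2 h)
  · intro h
    exact D.tk_mono.lt_iff_lt.1 (h.trans_le (D.le_tk_count t))

theorem count_eq (D : ImpulseData ω p a tk α) {t : ℝ} {n : ℕ}
    (h : ∀ k, k < n ↔ tk k < t) : impulseCount tk t = n := by
  refine le_antisymm (le_of_forall_lt fun k hk => ?_) (le_of_forall_lt fun k hk => ?_)
  · exact (h k).2 (D.lt_count.1 hk)
  · exact D.lt_count.2 ((h k).1 hk)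

theorem count_tk (D : ImpulseData ω p a tk α) (k : ℕ) : impulseCount tk (tk k) = k :=
  D.count_eq fun _ => D.tk_mono.lt_iff_lt.symm

theorem count_add (D : ImpulseData ω p a tk α) {t : ℝ} (ht : 0 ≤ t) :
    impulseCount tk (t + ω) = impulseCount tk t + p := by
  refine D.count_eq fun k => ?_
  rcases lt_or_ge k p with h | h
  · have := (D.tk_mem k h).2
    exact ⟨fun _ => by linarith, fun _ => by omega⟩
  · obtain ⟨j, rfl⟩ := Nat.exists_eq_add_of_le' h
    rw [D.tk_per, add_lt_add_iff_right, add_lt_add_iff_right, D.lt_count]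

theorem eventually_count_left (D : ImpulseData ω p a tk α) (t : ℝ) :
    ∀ᶠ r in 𝓝[≤] t, impulseCount tk r = impulseCount tk t := by
  have h : ∀ u, (∀ k, tk k < t → tk k < u ∨ tk k = u) → ∀ r, u < r → r ≤ t →
      impulseCount tk r = impulseCount tk t := by
    intro u hu r hur hrt
    refine D.count_eq fun k => D.lt_count.trans ⟨fun hk => ?_, fun hk => hk.trans_le hrt⟩
    rcases hu k hk with h | h <;> linarith
  rcases Nat.eq_zero_or_pos (impulseCount tk t) with h0 | h0
  · filter_upwards [self_mem_nhdsWithin, mem_nhdsWithin_of_mem_nhds (Ioi_mem_nhds (sub_one_lt t))]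
      with r hr hr2
    refine h (t - 1) (fun k hk => ?_) r hr2 hr
    have := D.lt_count.2 hk
    omega
  · have h1 : tk (impulseCount tk t - 1) < t := D.lt_count.1 (by omega)
    filter_upwards [self_mem_nhdsWithin, mem_nhdsWithin_of_mem_nhds (Ioi_mem_nhds h1)]
      with r hr hr2
    refine h _ (fun k hk => ?_) r hr2 hr
    have h2 := D.lt_count.2 hk
    exact (D.tk_mono.monotone (show k ≤ impulseCount tk t - 1 by omega)).lt_or_eq

theorem eventually_count_right (D : ImpulseData ω p a tk α) {t : ℝ} (ht : ∀ k, t ≠ tk k) :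
    ∀ᶠ r in 𝓝[>] t, impulseCount tk r = impulseCount tk t := by
  have h1 : t < tk (impulseCount tk t) := lt_of_le_of_ne (D.le_tk_count t) (ht _)
  filter_upwards [Ioo_mem_nhdsGT h1] with r hr
  refine D.count_eq fun k => ⟨fun h => (D.lt_count.1 h).trans hr.1, fun h => ?_⟩
  exact D.tk_mono.lt_iff_lt.1 (h.trans hr.2)

theorem eventually_count_tk_right (D : ImpulseData ω p a tk α) (k : ℕ) :
    ∀ᶠ r in 𝓝[>] (tk k), impulseCount tk r = k + 1 := by
  filter_upwards [Ioo_mem_nhdsGT (D.tk_mono (Nat.lt_succ_self k))] with r hr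
  refine D.count_eq fun j => ⟨fun h => ?_, fun h => ?_⟩
  · exact (D.tk_mono.monotone (Nat.lt_succ_iff.1 h)).trans_lt hr.1
  · exact D.tk_mono.lt_iff_lt.1 (h.trans hr.2)

theorem eventually_ne_tk (D : ImpulseData ω p a tk α) (t : ℝ) :
    ∀ᶠ r in 𝓝[<] t, ∀ k, r ≠ tk k := by
  filter_upwards [(D.eventually_count_left t).filter_mono
    (nhdsWithin_mono _ Iio_subset_Iic_self), self_mem_nhdsWithin] with r hr hrt k hk
  have hrt' : r < t := hrt
  rw [hk, D.count_tk] at hr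
  have := D.le_tk_count t
  rw [← hr, ← hk] at this
  linarith

theorem jumpProd_pos (D : ImpulseData ω p a tk α) (t : ℝ) : 0 < jumpProd tk α t :=
  Finset.prod_pos fun k _ => D.α_pos k

theorem growthFactor_pos (t : ℝ) : 0 < growthFactor a t := Real.exp_pos _

theorem jumpProd_add (D : ImpulseData ω p a tk α) {t : ℝ} (ht : 0 ≤ t) :
    jumpProd tk α (t + ω) = (∏ k ∈ Finset.range p, α k) * jumpProd tk α t := by
  unfold jumpProd
  rw [D.count_add ht, add_comm, Finset.prod_range_add]
  congr 1
  exact Finset.prod_congr rfl fun k _ => by rw [add_comm, D.α_per]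

theorem hasDerivAt_growthFactor (D : ImpulseData ω p a tk α) (t : ℝ) :
    HasDerivAt (growthFactor a) (a t * growthFactor a t) t := by
  have h := (D.a_cont.integral_hasStrictDerivAt 0 t).hasDerivAt.exp
  rw [mul_comm]; exact h

theorem growthFactor_add (D : ImpulseData ω p a tk α) (t : ℝ) :
    growthFactor a (t + ω) = Real.exp (∫ u in (0:ℝ)..ω, a u) * growthFactor a t := by
  unfold growthFactor
  rw [← Real.exp_add]
  congr 1
  have hi : ∀ x y, IntervalIntegrable a MeasureTheory.volume x y :=
    fun x y => D.a_cont.intervalIntegrable x y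
  rw [← intervalIntegral.integral_add_adjacent_intervals (hi 0 t) (hi t (t + ω)),
    D.a_per.intervalIntegral_add_eq t 0, zero_add, add_comm]

theorem integral_pos (D : ImpulseData ω p a tk α) : 0 < ∫ u in (0:ℝ)..ω, a u :=
  intervalIntegral.intervalIntegral_pos_of_pos (D.a_cont.intervalIntegrable _ _) D.a_pos D.ω_pos

theorem tendsto_growthFactor (D : ImpulseData ω p a tk α) :
    Tendsto (growthFactor a) atTop atTop :=
  Real.tendsto_exp_atTop.comp
    (D.a_per.tendsto_atTop_intervalIntegral_of_pos D.integral_pos D.ω_pos)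

end ImpulseData

/-- On `(T, ∞)`, `y` has derivative `-a y + f` off the impulse times (left derivatives), is left
continuous, and is multiplied by `P k` at the impulse time `tk k`. -/
structure IsImpulsiveSolution (a : ℝ → ℝ) (tk P : ℕ → ℝ) (f y : ℝ → ℝ) (T : ℝ) : Prop where
  left_cont : ∀ t > T, ContinuousWithinAt y (Iic t) t
  cont : ∀ t > T, (∀ k, t ≠ tk k) → ContinuousAt y t
  deriv : ∀ t > T, (∀ k, t ≠ tk k) → HasDerivWithinAt y (-(a t * y t) + f t) (Iic t) t
  jump : ∀ k, tk k > T → Tendsto y (𝓝[>] (tk k)) (𝓝 (P k * y (tk k)))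

namespace IsImpulsiveSolution

variable {ω : ℝ} {p : ℕ} {a : ℝ → ℝ} {tk α P : ℕ → ℝ} {f y : ℝ → ℝ} {T : ℝ}

theorem mono (h : IsImpulsiveSolution a tk P f y T) {T' : ℝ} (hT : T ≤ T') :
    IsImpulsiveSolution a tk P f y T' :=
  ⟨fun t ht => h.left_cont t (hT.trans_lt ht), fun t ht => h.cont t (hT.trans_lt ht),
    fun t ht => h.deriv t (hT.trans_lt ht), fun k hk => h.jump k (hT.trans_lt hk)⟩

theorem neg (h : IsImpulsiveSolution a tk P f y T) :
    IsImpulsiveSolution a tk P (fun t => -f t) (fun t => -y t) T where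
  left_cont t ht := (h.left_cont t ht).neg
  cont t ht hk := (h.cont t ht hk).neg
  deriv t ht hk := (h.deriv t ht hk).neg.congr_deriv (by ring)
  jump k hk := by
    convert (h.jump k hk).neg using 2
    ring

theorem eventually_normalized_left (D : ImpulseData ω p a tk α) (y : ℝ → ℝ) (t : ℝ) :
    normalized a tk α y =ᶠ[𝓝[≤] t] fun r => y r * (growthFactor a r / jumpProd tk α t) := by
  filter_upwards [D.eventually_count_left t] with r hr
  simp only [normalized, jumpProd, hr]

theorem normalized_left_cont (h : IsImpulsiveSolution a tk P f y T)
    (D : ImpulseData ω p a tk α) {t : ℝ} (ht : T < t) :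
    ContinuousWithinAt (normalized a tk α y) (Iic t) t := by
  refine ContinuousWithinAt.congr_of_eventuallyEq ?_ (eventually_normalized_left D y t) rfl
  exact (h.left_cont t ht).mul
    ((D.hasDerivAt_growthFactor t).continuousAt.continuousWithinAt.div_const _)

theorem normalized_deriv (h : IsImpulsiveSolution a tk P f y T)
    (D : ImpulseData ω p a tk α) {t : ℝ} (ht : T < t) (hk : ∀ k, t ≠ tk k) :
    HasDerivWithinAt (normalized a tk α y) (f t * (growthFactor a t / jumpProd tk α t))
      (Iic t) t := by
  refine HasDerivWithinAt.congr_of_eventuallyEq ?_ (eventually_normalized_left D y t) rfl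
  exact ((h.deriv t ht hk).mul ((D.hasDerivAt_growthFactor t).hasDerivWithinAt.div_const
    (jumpProd tk α t))).congr_deriv (by ring)

theorem normalized_right (h : IsImpulsiveSolution a tk P f y T)
    (D : ImpulseData ω p a tk α) {t : ℝ} (ht : T < t) (hk : ∀ k, t ≠ tk k) :
    Tendsto (normalized a tk α y) (𝓝[>] t) (𝓝 (normalized a tk α y t)) := by
  have h1 : (fun r => y r * (growthFactor a r / jumpProd tk α t)) =ᶠ[𝓝[>] t]
      normalized a tk α y := by
    filter_upwards [D.eventually_count_right hk] with r hr
    simp only [normalized, jumpProd, hr]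
  refine Tendsto.congr' h1 ?_
  exact ((h.cont t ht hk).mul
    ((D.hasDerivAt_growthFactor t).continuousAt.div_const _)).tendsto.mono_left
      nhdsWithin_le_nhds

theorem normalized_jump (h : IsImpulsiveSolution a tk P f y T)
    (D : ImpulseData ω p a tk α) {k : ℕ} (hk : T < tk k) :
    Tendsto (normalized a tk α y) (𝓝[>] (tk k))
      (𝓝 (P k / α k * normalized a tk α y (tk k))) := by
  have h1 : (fun r => y r * (growthFactor a r / (jumpProd tk α (tk k) * α k)))
      =ᶠ[𝓝[>] (tk k)] normalized a tk α y := by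
    filter_upwards [D.eventually_count_tk_right k] with r hr
    simp only [normalized, jumpProd, hr, D.count_tk, Finset.prod_range_succ]
  refine Tendsto.congr' h1 ?_
  have h2 := (h.jump k hk).mul (((D.hasDerivAt_growthFactor (tk k)).continuousAt.div_const
    (jumpProd tk α (tk k) * α k)).tendsto.mono_left nhdsWithin_le_nhds)
  convert h2 using 2
  have := (D.α_pos k).ne'
  have := (D.jumpProd_pos (tk k)).ne'
  simp only [normalized]
  field_simp

theorem normalized_antitone (h : IsImpulsiveSolution a tk P f y T)
    (D : ImpulseData ω p a tk α) {s t : ℝ} (hs : T < s) (hst : s ≤ t)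
    (hf : ∀ r ∈ Ioc s t, f r ≤ 0)
    (hj : ∀ k, s ≤ tk k → tk k < t → P k * y (tk k) ≤ α k * y (tk k)) :
    normalized a tk α y t ≤ normalized a tk α y s := by
  have hw : ∀ r, 0 < growthFactor a r / jumpProd tk α r := fun r =>
    div_pos (ImpulseData.growthFactor_pos r) (D.jumpProd_pos r)
  refine le_of_left_deriv_nonpos hst D.eventually_ne_tk (fun r hr hk => ?_)
    (fun r hr => h.normalized_left_cont D (hs.trans hr.1)) (fun r hr => ?_)
  · exact ⟨_, mul_nonpos_of_nonpos_of_nonneg (hf r hr) (hw r).le,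
      h.normalized_deriv D (hs.trans hr.1) hk⟩
  · by_cases hk : ∀ k, r ≠ tk k
    · exact ⟨_, le_rfl, h.normalized_right D (hs.trans_le hr.1) hk⟩
    · push Not at hk
      obtain ⟨k, rfl⟩ := hk
      refine ⟨_, ?_, h.normalized_jump D (hs.trans_le hr.1)⟩
      have h1 := hj k hr.1 hr.2
      have h2 : P k / α k * y (tk k) ≤ y (tk k) := by
        rw [div_mul_eq_mul_div, div_le_iff₀ (D.α_pos k)]; linarith
      unfold normalized
      rw [← mul_assoc]
      exact mul_le_mul_of_nonneg_right h2 (hw _).le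

end IsImpulsiveSolution

/-- The continuous part of `normalized a tk α y`, up to the additive constant `c`. -/
def cumulative (a : ℝ → ℝ) (tk α P : ℕ → ℝ) (y : ℝ → ℝ) (c t : ℝ) : ℝ :=
  normalized a tk α y t +
    ∑ k ∈ Finset.range (impulseCount tk t), (1 - P k / α k) * normalized a tk α y (tk k) + c

namespace IsImpulsiveSolution

variable {ω : ℝ} {p : ℕ} {a : ℝ → ℝ} {tk α P : ℕ → ℝ} {f y : ℝ → ℝ} {T c : ℝ}

theorem eventually_cumulative_left (D : ImpulseData ω p a tk α) (y : ℝ → ℝ) (t : ℝ) :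
    cumulative a tk α P y c =ᶠ[𝓝[≤] t] fun r => normalized a tk α y r +
      ∑ k ∈ Finset.range (impulseCount tk t), (1 - P k / α k) * normalized a tk α y (tk k)
        + c := by
  filter_upwards [D.eventually_count_left t] with r hr
  simp only [cumulative, hr]

theorem cumulative_left_cont (h : IsImpulsiveSolution a tk P f y T)
    (D : ImpulseData ω p a tk α) {t : ℝ} (ht : T < t) :
    ContinuousWithinAt (cumulative a tk α P y c) (Iic t) t :=
  (((h.normalized_left_cont D ht).add continuousWithinAt_const).add
    continuousWithinAt_const).congr_of_eventuallyEq (eventually_cumulative_left D y t) rfl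

theorem cumulative_deriv (h : IsImpulsiveSolution a tk P f y T)
    (D : ImpulseData ω p a tk α) {t : ℝ} (ht : T < t) (hk : ∀ k, t ≠ tk k) :
    HasDerivWithinAt (cumulative a tk α P y c)
      (f t * (growthFactor a t / jumpProd tk α t)) (Iic t) t :=
  (((h.normalized_deriv D ht hk).add_const _).add_const _).congr_of_eventuallyEq
    (eventually_cumulative_left D y t) rfl

theorem cumulative_right (h : IsImpulsiveSolution a tk P f y T)
    (D : ImpulseData ω p a tk α) {t : ℝ} (ht : T < t) :
    Tendsto (cumulative a tk α P y c) (𝓝[>] t) (𝓝 (cumulative a tk α P y c t)) := by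
  by_cases hk : ∀ k, t ≠ tk k
  · have h1 : (fun r => normalized a tk α y r + ∑ k ∈ Finset.range (impulseCount tk t),
        (1 - P k / α k) * normalized a tk α y (tk k) + c) =ᶠ[𝓝[>] t]
        cumulative a tk α P y c := by
      filter_upwards [D.eventually_count_right hk] with r hr
      simp only [cumulative, hr]
    exact Tendsto.congr' h1 (((h.normalized_right D ht hk).add_const _).add_const _)
  · push Not at hk
    obtain ⟨k, rfl⟩ := hk
    have h1 : (fun r => normalized a tk α y r + ∑ j ∈ Finset.range (k + 1),
        (1 - P j / α j) * normalized a tk α y (tk j) + c) =ᶠ[𝓝[>] (tk k)]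
        cumulative a tk α P y c := by
      filter_upwards [D.eventually_count_tk_right k] with r hr
      simp only [cumulative, hr]
    refine Tendsto.congr' h1 ?_
    convert ((h.normalized_jump D ht).add_const _).add_const _ using 2
    simp only [cumulative, D.count_tk, Finset.sum_range_succ]
    ring

theorem cumulative_monotone (h : IsImpulsiveSolution a tk P f y T)
    (D : ImpulseData ω p a tk α) {s t : ℝ} (hs : T < s) (hst : s ≤ t)
    (hf : ∀ r ∈ Ioc s t, 0 ≤ f r) :
    cumulative a tk α P y c s ≤ cumulative a tk α P y c t := by
  refine neg_le_neg_iff.1 (le_of_left_deriv_nonpos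
    (G := fun r => -cumulative a tk α P y c r) hst D.eventually_ne_tk
    (fun r hr hk => ⟨_, ?_, (h.cumulative_deriv D (hs.trans hr.1) hk).neg⟩)
    (fun r hr => (h.cumulative_left_cont D (hs.trans hr.1)).neg)
    (fun r hr => ⟨_, le_rfl, (h.cumulative_right D (hs.trans_le hr.1)).neg⟩))
  exact neg_nonpos.2 (mul_nonneg (hf r hr)
    (div_pos (ImpulseData.growthFactor_pos r) (D.jumpProd_pos r)).le)

theorem normalized_add_period (D : ImpulseData ω p a tk α)
    (hα : ∏ k ∈ Finset.range p, α k = 1) (hy : ∀ t, y (t + ω) = y t) {t : ℝ} (ht : 0 ≤ t) :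
    normalized a tk α y (t + ω)
      = Real.exp (∫ u in (0:ℝ)..ω, a u) * normalized a tk α y t := by
  unfold normalized
  rw [hy, D.growthFactor_add, D.jumpProd_add ht, hα]
  ring

theorem tk_pos (D : ImpulseData ω p a tk α) (hp : 0 < p) (k : ℕ) : 0 < tk k :=
  (D.tk_mem 0 hp).1.trans_le (D.tk_mono.monotone (Nat.zero_le k))

theorem sum_cumulative_add_period (D : ImpulseData ω p a tk α) (hp : 0 < p)
    (hα : ∏ k ∈ Finset.range p, α k = 1) (hP : ∀ k, P (k + p) = P k)
    (hy : ∀ t, y (t + ω) = y t) {t : ℝ} (ht : 0 ≤ t)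
    (hc : (Real.exp (∫ u in (0:ℝ)..ω, a u) - 1) * c
      = ∑ k ∈ Finset.range p, (1 - P k / α k) * normalized a tk α y (tk k)) :
    cumulative a tk α P y c (t + ω)
      = Real.exp (∫ u in (0:ℝ)..ω, a u) * cumulative a tk α P y c t := by
  unfold cumulative
  rw [normalized_add_period D hα hy ht, D.count_add ht, add_comm _ p, Finset.sum_range_add, ← hc]
  have : ∀ k, (1 - P (p + k) / α (p + k)) * normalized a tk α y (tk (p + k)) =
      Real.exp (∫ u in (0:ℝ)..ω, a u) * ((1 - P k / α k) * normalized a tk α y (tk k)) := by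
    intro k
    rw [add_comm p k, hP, D.α_per, D.tk_per, normalized_add_period D hα hy (tk_pos D hp k).le]
    ring
  simp only [this, ← Finset.mul_sum]
  ring

/-- Over one period the cumulative inflow is controlled by the current value of `y`. -/
theorem cumulative_le_normalized (h : IsImpulsiveSolution a tk P f y 0)
    (D : ImpulseData ω p a tk α) (hp : 0 < p)
    (hα : ∏ k ∈ Finset.range p, α k = 1) (hP : ∀ k, P (k + p) = P k)
    (hP0 : ∀ k, 0 < P k) (hPα : ∀ k, P k ≤ α k)
    (hy : ∀ t, y (t + ω) = y t) (hf : ∀ t > 0, 0 ≤ f t)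
    (hc : (Real.exp (∫ u in (0:ℝ)..ω, a u) - 1) * c
      = ∑ k ∈ Finset.range p, (1 - P k / α k) * normalized a tk α y (tk k))
    {t : ℝ} (ht : 0 < t) :
    (Real.exp (∫ u in (0:ℝ)..ω, a u) - 1) * cumulative a tk α P y c (t + ω)
      ≤ (Real.exp (∫ u in (0:ℝ)..ω, a u) * (∏ k ∈ Finset.range p, P k)⁻¹ - 1)
        * normalized a tk α y (t + ω) := by
  set Z := Real.exp (∫ u in (0:ℝ)..ω, a u) with hZ
  set n := normalized a tk α y with hn
  have D' : ImpulseData ω p a tk P := { D with α_pos := hP0, α_per := hP }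
  set c₀ := impulseCount tk t with hc₀
  set A : ℕ → ℝ := fun k => ∏ j ∈ Finset.range k, P j / α j with hA
  have hApos : ∀ k, 0 < A k := fun k =>
    Finset.prod_pos fun j _ => div_pos (hP0 j) (D.α_pos j)
  have hA' : ∀ r, normalized a tk P y r = n r / A (impulseCount tk r) := by
    intro r
    have h1 := (D.jumpProd_pos r).ne'
    have h2 := (D'.jumpProd_pos r).ne'
    simp only [hn, hA, normalized, Finset.prod_div_distrib]
    simp only [jumpProd] at h1 h2 ⊢
    field_simp
  have hAp : A (c₀ + p) = (∏ k ∈ Finset.range p, P k) * A c₀ := by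
    have : ∀ k, P (p + k) / α (p + k) = P k / α k := fun k => by
      rw [add_comm p k, hP, D.α_per]
    simp only [hA]
    rw [add_comm, Finset.prod_range_add]
    simp only [this]
    rw [Finset.prod_div_distrib (s := Finset.range p), hα, div_one]
  have hterm : ∀ k, k ∈ Finset.Ico c₀ (c₀ + p) → (1 - P k / α k) * n (tk k) ≤
      n (t + ω) / A (c₀ + p) * (A k - A (k + 1)) := by
    intro k hk
    have hk2 : tk k < t + ω := by
      rw [← D.lt_count, D.count_add ht.le]; exact (Finset.mem_Ico.1 hk).2
    have h1 : normalized a tk P y (tk k) ≤ normalized a tk P y (t + ω) := by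
      have := h.neg.normalized_antitone D' (tk_pos D hp k) hk2.le
        (fun r hr => by
          have := hf r ((tk_pos D hp k).trans hr.1); linarith) (fun _ _ _ => le_rfl)
      simpa [normalized] using this
    rw [hA', hA', D.count_tk, D.count_add ht.le, ← hc₀] at h1
    have h3 : A (k + 1) = A k * (P k / α k) := Finset.prod_range_succ _ _
    have h4 : P k / α k ≤ 1 := (div_le_one (D.α_pos k)).2 (hPα k)
    rw [div_le_iff₀ (hApos k)] at h1
    rw [h3]
    calc (1 - P k / α k) * n (tk k) ≤ (1 - P k / α k) * (n (t + ω) / A (c₀ + p) * A k) :=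
          mul_le_mul_of_nonneg_left h1 (by linarith)
      _ = _ := by ring
  have hsum := Finset.sum_le_sum hterm
  rw [← Finset.mul_sum, Finset.sum_Ico_eq_sum_range, Finset.sum_Ico_eq_sum_range,
    Nat.add_sub_cancel_left] at hsum
  have htel : ∑ k ∈ Finset.range p, (A (c₀ + k) - A (c₀ + k + 1)) = A c₀ - A (c₀ + p) :=
    Finset.sum_range_sub' (fun k => A (c₀ + k)) p
  rw [htel] at hsum
  have hper := sum_cumulative_add_period D hp hα hP hy ht.le hc
  have hdiff : cumulative a tk α P y c (t + ω) - cumulative a tk α P y c t =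
      n (t + ω) - n t +
        ∑ k ∈ Finset.range p, (1 - P (c₀ + k) / α (c₀ + k)) * n (tk (c₀ + k)) := by
    unfold cumulative
    rw [D.count_add ht.le, Finset.sum_range_add]
    ring
  have hnper : n (t + ω) = Z * n t := normalized_add_period D hα hy ht.le
  have h5 : n (t + ω) / A (c₀ + p) * (A c₀ - A (c₀ + p)) =
      n (t + ω) * ((∏ k ∈ Finset.range p, P k)⁻¹ - 1) := by
    have h6 : (∏ k ∈ Finset.range p, P k) ≠ 0 := (Finset.prod_pos fun k _ => hP0 k).ne'
    rw [hAp]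
    have := (hApos c₀).ne'
    field_simp
  rw [h5] at hsum
  have hZ0 : 0 < Z := Real.exp_pos _
  rw [← hZ] at hper
  calc (Z - 1) * cumulative a tk α P y c (t + ω)
      = Z * (cumulative a tk α P y c (t + ω) - cumulative a tk α P y c t) := by
        rw [hper]; ring
    _ ≤ Z * (n (t + ω) - n t + n (t + ω) * ((∏ k ∈ Finset.range p, P k)⁻¹ - 1)) := by
        rw [hdiff]; gcongr
    _ = _ := by rw [hnper]; ring

end IsImpulsiveSolution

namespace IsImpulsiveSolution

variable {ω : ℝ} {p : ℕ} {a : ℝ → ℝ} {tk α P R : ℕ → ℝ} {f y h x : ℝ → ℝ} {T c : ℝ}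

theorem exists_last_nonpos (hy : IsImpulsiveSolution a tk P f y T) {ξ t : ℝ} (hξ : T < ξ)
    (hξt : ξ ≤ t) (h0 : y ξ ≤ 0) (ht : 0 < y t) :
    ∃ s, ξ ≤ s ∧ s < t ∧ y s ≤ 0 ∧ ∀ r ∈ Ioc s t, 0 < y r := by
  set S : Set ℝ := {s | s ∈ Icc ξ t ∧ y s ≤ 0} with hS
  have hne : S.Nonempty := ⟨ξ, ⟨le_rfl, hξt⟩, h0⟩
  have hbd : BddAbove S := ⟨t, fun s hs => hs.1.2⟩
  have h1 : ξ ≤ sSup S := le_csSup hbd ⟨⟨le_rfl, hξt⟩, h0⟩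
  have h2 : sSup S ≤ t := csSup_le hne fun s hs => hs.1.2
  have h3 : y (sSup S) ≤ 0 := by
    by_contra hn
    obtain ⟨u, hu, hu'⟩ := mem_nhdsLE_iff_exists_Ioc_subset.1
      ((hy.left_cont _ (hξ.trans_le h1)).eventually (lt_mem_nhds (not_le.1 hn)))
    obtain ⟨q, hq, hq2⟩ := exists_lt_of_lt_csSup hne (show u < sSup S from hu)
    have h4 : 0 < y q := hu' ⟨hq2, le_csSup hbd hq⟩
    exact absurd hq.2 (not_le.2 h4)
  refine ⟨sSup S, h1, lt_of_le_of_ne h2 fun h => ?_, h3, fun r hr => ?_⟩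
  · rw [h] at h3; linarith
  · by_contra hn
    exact absurd (le_csSup hbd ⟨⟨h1.trans hr.1.le, hr.2⟩, not_lt.1 hn⟩) (not_le.2 hr.1)

theorem eq_zero_of_pos_right (hy : IsImpulsiveSolution a tk P f y T) (hP : ∀ k, 0 < P k)
    {s t : ℝ} (hs : T < s) (hst : s < t) (h0 : y s ≤ 0) (hpos : ∀ r ∈ Ioc s t, 0 < y r) :
    y s = 0 := by
  refine le_antisymm h0 ?_
  have hev : ∀ᶠ r in 𝓝[>] s, 0 ≤ y r := by
    filter_upwards [Ioo_mem_nhdsGT hst] with r hr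
    exact (hpos r ⟨hr.1, hr.2.le⟩).le
  by_cases hk : ∀ k, s ≠ tk k
  · exact ge_of_tendsto ((hy.cont s hs hk).tendsto.mono_left nhdsWithin_le_nhds) hev
  · push Not at hk
    obtain ⟨k, rfl⟩ := hk
    exact nonneg_of_mul_nonneg_right (ge_of_tendsto (hy.jump k hs) hev) (hP k)

theorem cumulative_add_nat_mul (D : ImpulseData ω p a tk α) (hp : 0 < p)
    (hα : ∏ k ∈ Finset.range p, α k = 1) (hR : ∀ k, R (k + p) = R k)
    (hx : ∀ t, x (t + ω) = x t)
    (hc : (Real.exp (∫ u in (0:ℝ)..ω, a u) - 1) * c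
      = ∑ k ∈ Finset.range p, (1 - R k / α k) * normalized a tk α x (tk k))
    {t : ℝ} (ht : 0 ≤ t) (j : ℕ) :
    cumulative a tk α R x c (t + j * ω)
      = Real.exp (∫ u in (0:ℝ)..ω, a u) ^ j * cumulative a tk α R x c t := by
  induction j with
  | zero => simp
  | succ j ih =>
    have h1 : 0 ≤ t + j * ω := add_nonneg ht (mul_nonneg (Nat.cast_nonneg j) D.ω_pos.le)
    have h2 : t + ((j + 1 : ℕ) : ℝ) * ω = (t + j * ω) + ω := by push_cast; ring
    rw [h2, sum_cumulative_add_period D hp hα hR hx h1 hc, ih, pow_succ]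
    ring

/-- If the forcing of `y` is at most `M` times that of the periodic function `x`, and is
nonpositive once `y` has been nonnegative for `m` periods, then `y` is controlled from its first
nonpositive value on. -/
theorem normalized_le_cumulative (hy : IsImpulsiveSolution a tk P f y T)
    (hx : IsImpulsiveSolution a tk R h x 0)
    (D : ImpulseData ω p a tk α) (hp : 0 < p) (hα : ∏ k ∈ Finset.range p, α k = 1)
    (hP : ∀ k, 0 < P k) (hPα : ∀ k, P k ≤ α k) (hR : ∀ k, R (k + p) = R k)
    (hxper : ∀ t, x (t + ω) = x t)
    (hc : (Real.exp (∫ u in (0:ℝ)..ω, a u) - 1) * c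
      = ∑ k ∈ Finset.range p, (1 - R k / α k) * normalized a tk α x (tk k))
    (hh : ∀ t > 0, 0 ≤ h t) (hF : ∀ t > 0, 0 ≤ cumulative a tk α R x c t)
    (hT : 0 ≤ T) {ξ M : ℝ} {m : ℕ} (hξ : T < ξ) (hM : 0 ≤ M)
    (hf1 : ∀ r > ξ, f r ≤ M * h r)
    (hf2 : ∀ r > ξ + m * ω, (∀ s ∈ Ico (r - m * ω) r, 0 ≤ y s) → f r ≤ 0)
    (hyξ : y ξ ≤ 0) {t : ℝ} (ht : ξ ≤ t) :
    Real.exp (∫ u in (0:ℝ)..ω, a u) ^ m * normalized a tk α y t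
      ≤ M * ((Real.exp (∫ u in (0:ℝ)..ω, a u) ^ m - 1) * cumulative a tk α R x c t) := by
  set Z := Real.exp (∫ u in (0:ℝ)..ω, a u) with hZ
  set F := cumulative a tk α R x c with hFdef
  have hw : ∀ r, 0 < growthFactor a r / jumpProd tk α r := fun r =>
    div_pos (ImpulseData.growthFactor_pos r) (D.jumpProd_pos r)
  have hZ0 : 0 < Z := Real.exp_pos _
  have hZ1 : 1 ≤ Z ^ m := one_le_pow₀ (Real.one_le_exp D.integral_pos.le)
  have ht0 : 0 < t := hT.trans_lt (hξ.trans_le ht)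
  have hmω : 0 ≤ m * ω := mul_nonneg (Nat.cast_nonneg m) D.ω_pos.le
  rcases le_or_gt (y t) 0 with hyt | hyt
  · have h1 : normalized a tk α y t ≤ 0 := mul_nonpos_of_nonpos_of_nonneg hyt (hw t).le
    have h2 : 0 ≤ M * ((Z ^ m - 1) * F t) :=
      mul_nonneg hM (mul_nonneg (by linarith) (hF t ht0))
    have h3 : Z ^ m * normalized a tk α y t ≤ 0 :=
      mul_nonpos_of_nonneg_of_nonpos (by positivity) h1
    linarith
  obtain ⟨s, hs1, hs2, hs3, hs4⟩ := hy.exists_last_nonpos hξ ht hyξ hyt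
  have hTs : T < s := hξ.trans_le hs1
  have hs0 : 0 < s := hT.trans_lt hTs
  have hys : y s = 0 := hy.eq_zero_of_pos_right hP hTs hs2 hs3 hs4
  have hnn : ∀ r, s ≤ r → r ≤ t → 0 ≤ y r := fun r h1 h2 => by
    rcases h1.eq_or_lt with h | h
    · rw [← h, hys]
    · exact (hs4 r ⟨h, h2⟩).le
  set t₁ := min t (s + m * ω) with ht₁
  have hst₁ : s ≤ t₁ := le_min hs2.le (by linarith)
  have ht₁t : t₁ ≤ t := min_le_left _ _
  have step1 : normalized a tk α y t₁ ≤ M * (F t₁ - F s) := by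
    have hmono := le_of_left_deriv_nonpos (G := fun r => normalized a tk α y r - M * F r)
      hst₁ D.eventually_ne_tk
      (fun r hr hk => ⟨_, ?_, (hy.normalized_deriv D (hTs.trans hr.1) hk).sub
        ((hx.cumulative_deriv D (hs0.trans hr.1) hk).const_mul M)⟩)
      (fun r hr => (hy.normalized_left_cont D (hTs.trans hr.1)).sub
        ((hx.cumulative_left_cont D (hs0.trans hr.1)).const_mul M))
      (fun r hr => ?_)
    · have h0 : normalized a tk α y s = 0 := by simp [normalized, hys]
      simp only [h0] at hmono
      linarith
    · have h1 := hf1 r (hs1.trans_lt hr.1)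
      rw [← mul_assoc, ← sub_mul]
      exact mul_nonpos_of_nonpos_of_nonneg (by linarith) (hw r).le
    · have hlim := (hx.cumulative_right (c := c) (α := α) D (hs0.trans_le hr.1)).const_mul M
      by_cases hk : ∀ k, r ≠ tk k
      · exact ⟨_, le_rfl, (hy.normalized_right D (hTs.trans_le hr.1) hk).sub hlim⟩
      · push Not at hk
        obtain ⟨k, rfl⟩ := hk
        refine ⟨_, ?_, (hy.normalized_jump D (hTs.trans_le hr.1)).sub hlim⟩
        have h1 : 0 ≤ normalized a tk α y (tk k) :=
          mul_nonneg (hnn _ hr.1 (hr.2.le.trans ht₁t)) (hw _).le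
        have h2 : P k / α k ≤ 1 := (div_le_one (D.α_pos k)).2 (hPα k)
        exact sub_le_sub_right (mul_le_of_le_one_left h1 h2) _
  have step2 : normalized a tk α y t ≤ normalized a tk α y t₁ := by
    refine hy.normalized_antitone D (hTs.trans_le hst₁) ht₁t (fun r hr => ?_) (fun k h1 h2 => ?_)
    · have hr1 : s + m * ω < r := by
        rcases min_lt_iff.1 hr.1 with h | h
        · exact absurd hr.2 (not_le.2 h)
        · exact h
      exact hf2 r (by linarith) fun q hq =>
        hnn q (by linarith [hq.1]) (hq.2.le.trans hr.2)
    · exact mul_le_mul_of_nonneg_right (hPα k) (hnn _ (hst₁.trans h1) h2.le)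
  have hF1 : F t₁ ≤ F t := hx.cumulative_monotone D (hs0.trans_le hst₁) ht₁t
    fun r hr => hh r ((hs0.trans_le hst₁).trans hr.1)
  have hF2 : F t₁ ≤ Z ^ m * F s := by
    rw [hZ, hFdef, ← cumulative_add_nat_mul D hp hα hR hxper hc hs0.le m]
    exact hx.cumulative_monotone D (hs0.trans_le hst₁) (min_le_right _ _)
      fun r hr => hh r ((hs0.trans_le hst₁).trans hr.1)
  calc Z ^ m * normalized a tk α y t ≤ Z ^ m * (M * (F t₁ - F s)) := by
        gcongr; exact step2.trans step1
    _ = M * (Z ^ m * F t₁ - Z ^ m * F s) := by ring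
    _ ≤ M * (Z ^ m * F t₁ - F t₁) := by gcongr
    _ = M * ((Z ^ m - 1) * F t₁) := by ring
    _ ≤ M * ((Z ^ m - 1) * F t) := by
        gcongr

theorem exists_jumpProd_le (D : ImpulseData ω p a tk α) (hp : 0 < p)
    (hα : ∏ k ∈ Finset.range p, α k = 1) : ∃ C, ∀ t, jumpProd tk α t ≤ C := by
  have hper : Function.Periodic (fun n => ∏ k ∈ Finset.range n, α k) p := by
    intro n
    have : ∀ k, α (p + k) = α k := fun k => by rw [add_comm, D.α_per]
    simp only
    rw [add_comm, Finset.prod_range_add, hα, one_mul]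
    exact Finset.prod_congr rfl fun k _ => this k
  refine ⟨∑ j ∈ Finset.range p, ∏ k ∈ Finset.range j, α k, fun t => ?_⟩
  have h := hper.map_mod_nat (impulseCount tk t)
  rw [jumpProd, ← h]
  exact Finset.single_le_sum (f := fun j => ∏ k ∈ Finset.range j, α k)
    (fun j _ => (Finset.prod_pos fun k _ => D.α_pos k).le)
    (Finset.mem_range.2 (Nat.mod_lt _ hp))

theorem tendsto_zero_of_nonneg (hy : IsImpulsiveSolution a tk P f y T)
    (D : ImpulseData ω p a tk α) (hp : 0 < p) (hα : ∏ k ∈ Finset.range p, α k = 1)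
    (hPα : ∀ k, P k ≤ α k) {s : ℝ} (hs : T < s) (hpos : ∀ t ≥ s, 0 ≤ y t)
    (hf : ∀ t > s, f t ≤ 0) : Tendsto y atTop (𝓝 0) := by
  obtain ⟨C, hC⟩ := exists_jumpProd_le D hp hα
  have hlim : Tendsto (fun t => normalized a tk α y s * C * (growthFactor a t)⁻¹) atTop (𝓝 0) := by
    simpa using (tendsto_inv_atTop_zero.comp D.tendsto_growthFactor).const_mul
      (normalized a tk α y s * C)
  refine tendsto_of_tendsto_of_tendsto_of_le_of_le' tendsto_const_nhds hlim ?_ ?_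
  · filter_upwards [eventually_ge_atTop s] with t ht using hpos t ht
  · filter_upwards [eventually_ge_atTop s] with t ht
    have h1 := hy.normalized_antitone D hs ht (fun r hr => hf r hr.1)
      (fun k hk _ => mul_le_mul_of_nonneg_right (hPα k) (hpos _ hk))
    have hg : 0 < growthFactor a t := ImpulseData.growthFactor_pos t
    have hJ := D.jumpProd_pos t
    have h2 : 0 ≤ normalized a tk α y s := mul_nonneg (hpos s le_rfl)
      (div_pos (ImpulseData.growthFactor_pos s) (D.jumpProd_pos s)).le
    have h3 : y t = normalized a tk α y t * jumpProd tk α t * (growthFactor a t)⁻¹ := by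
      unfold normalized; field_simp
    rw [h3]
    have h4 : normalized a tk α y t * jumpProd tk α t ≤ normalized a tk α y s * C :=
      (mul_le_mul_of_nonneg_right h1 hJ.le).trans (mul_le_mul_of_nonneg_left (hC t) h2)
    exact mul_le_mul_of_nonneg_right h4 (inv_pos.2 hg).le

/-- A negative feedback argument: alternating one-sided bounds contract. -/
theorem tendsto_zero_of_contraction (hy : IsImpulsiveSolution a tk P f y T)
    (D : ImpulseData ω p a tk α) (hp : 0 < p) (hα : ∏ k ∈ Finset.range p, α k = 1)
    (hPα : ∀ k, P k ≤ α k) {L E B C : ℝ} (hE : 0 ≤ E) (hB : 0 ≤ B) (hEB : E * B < 1)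
    (hxC : ∀ t, 0 < x t ∧ x t ≤ C) (hL : 0 ≤ L)
    (hlow : ∀ t ≥ T, -x t ≤ y t)
    (hfpos : ∀ t > T + L, (∀ s ∈ Ico (t - L) t, 0 ≤ y s) → f t ≤ 0)
    (hfneg : ∀ t > T + L, (∀ s ∈ Ico (t - L) t, y s ≤ 0) → 0 ≤ f t)
    (hup : ∀ v S ξ : ℝ, 0 ≤ v → v ≤ 1 → T ≤ S → S + L < ξ → (∀ t ≥ S, -(v * x t) ≤ y t) →
      y ξ ≤ 0 → ∀ t ≥ ξ, y t ≤ v * E * x t)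
    (hdown : ∀ u S ξ : ℝ, 0 ≤ u → T ≤ S → S + L < ξ → (∀ t ≥ S, y t ≤ u * x t) →
      0 ≤ y ξ → ∀ t ≥ ξ, -(u * B * x t) ≤ y t) :
    Tendsto y atTop (𝓝 0) := by
  by_cases h1 : ∃ s, ∀ t ≥ s, 0 ≤ y t
  · obtain ⟨s, hs⟩ := h1
    refine hy.tendsto_zero_of_nonneg D hp hα hPα (s := max s T + L + 1)
      (by linarith [le_max_right s T]) (fun t ht => hs t (by linarith [le_max_left s T]))
      fun t ht => hfpos t (by linarith [le_max_right s T]) fun r hr =>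
        hs r (by linarith [le_max_left s T, hr.1])
  by_cases h2 : ∃ s, ∀ t ≥ s, y t ≤ 0
  · obtain ⟨s, hs⟩ := h2
    have := hy.neg.tendsto_zero_of_nonneg D hp hα hPα (s := max s T + L + 1)
      (by linarith [le_max_right s T])
      (fun t ht => neg_nonneg.2 (hs t (by linarith [le_max_left s T])))
      fun t ht => neg_nonpos.2 (hfneg t (by linarith [le_max_right s T]) fun r hr =>
        hs r (by linarith [le_max_left s T, hr.1]))
    simpa using this.neg
  push Not at h1 h2
  have hθ0 : 0 ≤ E * B := mul_nonneg hE hB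
  have hiter : ∀ n : ℕ, ∃ S ≥ T, ∀ t ≥ S, -((E * B) ^ n * x t) ≤ y t := by
    intro n
    induction n with
    | zero => exact ⟨T, le_rfl, by simpa using hlow⟩
    | succ n ih =>
      obtain ⟨S, hS, hSy⟩ := ih
      obtain ⟨ξ, hξ, hyξ⟩ := h1 (S + L + 1)
      have hu := hup _ S ξ (pow_nonneg hθ0 n) (pow_le_one₀ hθ0 hEB.le) hS (by linarith) hSy hyξ.le
      obtain ⟨η, hη, hyη⟩ := h2 (ξ + L + 1)
      refine ⟨η, by linarith, ?_⟩
      have := hdown _ ξ η (mul_nonneg (pow_nonneg hθ0 n) hE) (by linarith) (by linarith) hu hyη.le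
      intro t ht
      rw [pow_succ, ← mul_assoc]
      exact this t ht
  have hC0 : 0 < C := (hxC 0).1.trans_le (hxC 0).2
  rw [Metric.tendsto_atTop]
  intro ε hε
  have hpow := (tendsto_pow_atTop_nhds_zero_of_lt_one hθ0 hEB).mul_const ((1 + E) * C)
  rw [zero_mul] at hpow
  obtain ⟨n, hn⟩ := (hpow.eventually (gt_mem_nhds hε)).exists
  obtain ⟨S, hS, hSy⟩ := hiter n
  obtain ⟨ξ, hξ, hyξ⟩ := h1 (S + L + 1)
  have hu := hup _ S ξ (pow_nonneg hθ0 n) (pow_le_one₀ hθ0 hEB.le) hS (by linarith) hSy hyξ.le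
  refine ⟨ξ, fun t ht => ?_⟩
  have h3 := hu t ht
  have h4 := hSy t (by linarith)
  have hq := pow_nonneg hθ0 n
  set q := (E * B) ^ n
  have hx1 : q * x t ≤ q * C := mul_le_mul_of_nonneg_left (hxC t).2 hq
  have hx2 : q * E * x t ≤ q * E * C := mul_le_mul_of_nonneg_left (hxC t).2 (mul_nonneg hq hE)
  have hx3 : 0 ≤ q * E * C := by positivity
  have hx4 : 0 ≤ q * C := by positivity
  rw [Real.dist_eq, sub_zero, abs_lt]
  constructor <;> nlinarith

end IsImpulsiveSolution

theorem one_add_sum_min_le_prod (bb : ℕ → ℝ) (hbb : ∀ k, -1 < bb k) (n : ℕ) :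
    1 + ∑ k ∈ Finset.range n, min (bb k) 0 ≤ ∏ k ∈ Finset.range n, (1 + bb k) := by
  have h : 1 + ∑ k ∈ Finset.range n, min (bb k) 0 ≤
        ∏ k ∈ Finset.range n, (1 + min (bb k) 0) ∧
      ∏ k ∈ Finset.range n, (1 + min (bb k) 0) ≤ 1 := by
    induction n with
    | zero => simp
    | succ n ih =>
      rw [Finset.sum_range_succ, Finset.prod_range_succ]
      have h1 : min (bb n) 0 ≤ 0 := min_le_right _ _
      have h2 : -1 < min (bb n) 0 := lt_min (hbb n) (by norm_num)
      have h3 : 0 ≤ ∏ k ∈ Finset.range n, (1 + min (bb k) 0) := Finset.prod_nonneg fun k _ => by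
        have : -1 < min (bb k) 0 := lt_min (hbb k) (by norm_num)
        linarith
      constructor <;> nlinarith [ih.1, ih.2]
  refine h.1.trans (Finset.prod_le_prod (fun k _ => ?_) fun k _ => ?_)
  · have : -1 < min (bb k) 0 := lt_min (hbb k) (by norm_num)
    linarith
  · linarith [min_le_left (bb k) 0]

theorem inv_sub_inv_le_of_prod {Z ρ B S : ℝ} (hZ : 1 < Z) (hρ : 0 < ρ) (hρ1 : ρ ≤ 1)
    (hB : ρ⁻¹ ≤ B) (hS : 1 - S ≤ ρ) : ρ⁻¹ - Z⁻¹ ≤ B * (1 - Z⁻¹ + S) := by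
  have hz0 : 0 < Z⁻¹ := inv_pos.2 (by linarith)
  have hz1 : Z⁻¹ < 1 := inv_lt_one_of_one_lt₀ hZ
  have h1 : ρ⁻¹ - Z⁻¹ = ρ⁻¹ * (1 - Z⁻¹ * ρ) := by field_simp
  have h2 : 0 ≤ 1 - Z⁻¹ * ρ := by nlinarith
  have h3 : 1 - Z⁻¹ * ρ ≤ 1 - Z⁻¹ + S := by nlinarith
  rw [h1]
  calc ρ⁻¹ * (1 - Z⁻¹ * ρ) ≤ B * (1 - Z⁻¹ * ρ) := mul_le_mul_of_nonneg_right hB h2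
    _ ≤ _ := mul_le_mul_of_nonneg_left h3 ((inv_pos.2 hρ).le.trans hB)

theorem pow_sub_one_mul_le {Z ρ B S F n : ℝ} {m : ℕ} (hm : 0 < m) (hZ : 1 < Z) (hB : 1 ≤ B)
    (hS : 0 ≤ S) (hn : 0 ≤ n) (hF : (Z - 1) * F ≤ (Z * ρ⁻¹ - 1) * n)
    (hρ : ρ⁻¹ - Z⁻¹ ≤ B * (1 - Z⁻¹ + S)) :
    (Z ^ m - 1) * F ≤ Z ^ m * (B ^ m * (1 - Z⁻¹ ^ m) * (1 + (1 - Z⁻¹)⁻¹ * S)) * n := by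
  have hZ0 : 0 < Z := by linarith
  have hz1 : Z⁻¹ < 1 := inv_lt_one_of_one_lt₀ hZ
  have hQ : 0 ≤ 1 + (1 - Z⁻¹)⁻¹ * S := by
    have : 0 < 1 - Z⁻¹ := by linarith
    positivity
  have h1 : Z * ρ⁻¹ - 1 ≤ (Z - 1) * (B * (1 + (1 - Z⁻¹)⁻¹ * S)) := by
    have e1 : Z * ρ⁻¹ - 1 = Z * (ρ⁻¹ - Z⁻¹) := by field_simp
    have e2 : (Z - 1) * (B * (1 + (1 - Z⁻¹)⁻¹ * S)) = Z * (B * (1 - Z⁻¹ + S)) := by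
      have h : Z - 1 = Z * (1 - Z⁻¹) := by field_simp
      have h0 : 1 - Z⁻¹ ≠ 0 := by linarith
      rw [h]
      calc Z * (1 - Z⁻¹) * (B * (1 + (1 - Z⁻¹)⁻¹ * S))
          = Z * (B * ((1 - Z⁻¹) + ((1 - Z⁻¹) * (1 - Z⁻¹)⁻¹) * S)) := by ring
        _ = _ := by rw [mul_inv_cancel₀ h0, one_mul]
    rw [e1, e2]
    gcongr
  have h2 : F ≤ B * (1 + (1 - Z⁻¹)⁻¹ * S) * n := by
    have h3 : (Z - 1) * F ≤ (Z - 1) * (B * (1 + (1 - Z⁻¹)⁻¹ * S) * n) := by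
      rw [← mul_assoc]
      exact hF.trans (mul_le_mul_of_nonneg_right h1 hn)
    exact le_of_mul_le_mul_left h3 (by linarith)
  have h4 : 0 ≤ Z ^ m - 1 := sub_nonneg.2 (one_le_pow₀ hZ.le)
  have h5 : B ≤ B ^ m := le_self_pow₀ hB hm.ne'
  have h6 : Z ^ m * (1 - Z⁻¹ ^ m) = Z ^ m - 1 := by
    rw [mul_sub, ← mul_pow, mul_inv_cancel₀ hZ0.ne', one_pow, mul_one]
  calc (Z ^ m - 1) * F ≤ (Z ^ m - 1) * (B ^ m * (1 + (1 - Z⁻¹)⁻¹ * S) * n) := by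
        refine mul_le_mul_of_nonneg_left (h2.trans ?_) h4
        gcongr
    _ = _ := by rw [← h6]; ring

theorem exp_neg_sub_le {β N X v s : ℝ} (hv0 : 0 ≤ v) (hv1 : v ≤ 1) (hβ : 0 < β)
    (hs : β * X ≤ s) (hN : -(v * X) ≤ N - X) :
    Real.exp (-(β * N)) - Real.exp (-(β * X)) ≤
      v * (Real.exp s - 1) * Real.exp (-(β * X)) := by
  have h1 : Real.exp (-(β * N)) = Real.exp (-(β * X)) * Real.exp (-(β * (N - X))) := by
    rw [← Real.exp_add]; ring_nf
  have h2 : Real.exp (-(β * (N - X))) ≤ Real.exp (v * s) := by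
    refine Real.exp_le_exp.2 ?_
    nlinarith [mul_le_mul_of_nonneg_left hs hv0, mul_le_mul_of_nonneg_left hN hβ.le]
  have h3 : Real.exp (v * s) ≤ v * Real.exp s + (1 - v) := by
    have := convexOn_exp.2 (mem_univ s) (mem_univ (0:ℝ)) hv0 (sub_nonneg.2 hv1) (by ring)
    simpa using this
  have h4 := Real.exp_pos (-(β * X))
  rw [h1]
  nlinarith

theorem exp_neg_sub_ge {β N X u s : ℝ} (hu : 0 ≤ u) (hβ : 0 < β)
    (hs : β * X ≤ s) (hN : N - X ≤ u * X) :
    -(u * s * Real.exp (-(β * X))) ≤ Real.exp (-(β * N)) - Real.exp (-(β * X)) := by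
  have h1 : Real.exp (-(β * N)) = Real.exp (-(β * X)) * Real.exp (-(β * (N - X))) := by
    rw [← Real.exp_add]; ring_nf
  have h2 := Real.add_one_le_exp (-(β * (N - X)))
  have h3 : β * (N - X) ≤ u * s := by
    nlinarith [mul_le_mul_of_nonneg_left hs hu, mul_le_mul_of_nonneg_left hN hβ.le]
  have h4 := Real.exp_pos (-(β * X))
  rw [h1]
  nlinarith

theorem bddAbove_image_of_one_sided_limits {x : ℝ → ℝ} {s : Set ℝ} (hs : IsCompact s)
    (hl : ∀ t ∈ s, ContinuousWithinAt x (Iic t) t)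
    (hr : ∀ t ∈ s, ∃ L, Tendsto x (𝓝[>] t) (𝓝 L)) : BddAbove (x '' s) := by
  refine hs.induction_on (p := fun u => BddAbove (x '' u)) (by simp)
    (fun u v huv hv => hv.mono (image_mono huv))
    (fun u v hu hv => by rw [image_union]; exact hu.union hv) fun t ht => ?_
  obtain ⟨L, hL⟩ := hr t ht
  have h1 := (hl t ht).eventually (gt_mem_nhds (lt_add_one (x t)))
  have h2 := hL.eventually (gt_mem_nhds (lt_add_one L))
  have h3 : ∀ᶠ r in 𝓝 t, x r ≤ max (x t + 1) (L + 1) := by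
    rw [← nhdsLE_sup_nhdsGT, eventually_sup]
    exact ⟨h1.mono fun r h => h.le.trans (le_max_left _ _),
      h2.mono fun r h => h.le.trans (le_max_right _ _)⟩
  refine ⟨_, mem_nhdsWithin_of_mem_nhds h3, max (x t + 1) (L + 1), ?_⟩
  rintro _ ⟨r, hr, rfl⟩
  exact hr

theorem le_sSup_of_periodic {ι : Type*} {g : ι → ℝ → ℝ} {ω C : ℝ} (hω : 0 < ω)
    (hg : ∀ i, Function.Periodic (g i) ω) (hC : ∀ i t, g i t ≤ C) (i : ι) (t : ℝ) :
    g i t ≤ sSup {x : ℝ | ∃ i, ∃ t ∈ Set.Icc (0:ℝ) ω, g i t = x} := by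
  obtain ⟨s, hs, hst⟩ := (hg i).exists_mem_Ico₀ hω t
  rw [hst]
  refine le_csSup ⟨C, ?_⟩ ⟨i, s, Ico_subset_Icc_self hs, rfl⟩
  rintro _ ⟨j, r, _, rfl⟩
  exact hC j r

theorem exists_le_of_periodic_family {ι : Type*} [Fintype ι] {g : ι → ℝ → ℝ} {ω : ℝ}
    (hω : 0 < ω) (hc : ∀ i, Continuous (g i)) (hg : ∀ i, Function.Periodic (g i) ω) :
    ∃ C, 0 ≤ C ∧ ∀ i t, g i t ≤ C := by
  have h : ∀ i, ∃ C, ∀ t, g i t ≤ C := by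
    intro i
    obtain ⟨C, hC⟩ := (isCompact_Icc (a := (0:ℝ)) (b := ω)).bddAbove_image (hc i).continuousOn
    refine ⟨C, fun t => ?_⟩
    obtain ⟨s, hs, hst⟩ := (hg i).exists_mem_Ico₀ hω t
    rw [hst]
    exact hC ⟨s, Ico_subset_Icc_self hs, rfl⟩
  choose C hC using h
  refine ⟨∑ i, |C i|, Finset.sum_nonneg fun i _ => abs_nonneg _, fun i t => ?_⟩
  exact ((hC i t).trans (le_abs_self _)).trans
    (Finset.single_le_sum (f := fun j => |C j|) (fun j _ => abs_nonneg _) (Finset.mem_univ i))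

theorem inv_prod_le_Bconst (p : ℕ) (hp : 0 < p) (bb : ℕ → ℝ)
    (hbb_per : ∀ k, bb (k + p) = bb k) :
    (∏ k ∈ Finset.range p, (1 + bb k))⁻¹ ≤ Bconst p hp bb := by
  have h := Finset.le_sup' (fun lj : ℕ × ℕ => ∏ k ∈ Finset.range lj.2, (1 + bb (lj.1 + k))⁻¹)
    (show (p, p) ∈ (Finset.Icc 1 p) ×ˢ (Finset.Icc 1 p) by simp; omega)
  refine le_trans (le_of_eq ?_) h
  rw [← Finset.prod_inv_distrib]
  exact Finset.prod_congr rfl fun k _ => by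
    show _ = (1 + bb (p + k))⁻¹
    rw [add_comm p k, hbb_per]

/-- Jump factors can be enlarged so that their product over a period equals one. -/
theorem exists_scaled_prod_eq_one (p : ℕ) (hp : 0 < p) (c : ℕ → ℝ) (hc : ∀ k, 0 < c k)
    (hper : ∀ k, c (k + p) = c k) (hprod : ∏ k ∈ Finset.range p, c k ≤ 1) :
    ∃ α : ℕ → ℝ, (∀ k, c k ≤ α k) ∧ (∀ k, α (k + p) = α k) ∧
      ∏ k ∈ Finset.range p, α k = 1 := by
  set q := ∏ k ∈ Finset.range p, c k
  have hq : 0 < q := Finset.prod_pos fun k _ => hc k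
  have hκ : 1 ≤ (q⁻¹) ^ ((p : ℝ)⁻¹) :=
    Real.one_le_rpow ((one_le_inv₀ hq).2 hprod) (by positivity)
  refine ⟨fun k => c k * (q⁻¹) ^ ((p : ℝ)⁻¹), fun k => ?_, fun k => ?_, ?_⟩
  · exact le_mul_of_one_le_right (hc k).le hκ
  · simp only [hper]
  · rw [Finset.prod_mul_distrib, Finset.prod_const, Finset.card_range,
      Real.rpow_inv_natCast_pow (inv_pos.2 hq).le hp.ne']
    exact mul_inv_cancel₀ hq.ne'

namespace IsImpulsiveSolution

variable {ω : ℝ} {p : ℕ} {a : ℝ → ℝ} {tk α P R : ℕ → ℝ} {f y h x : ℝ → ℝ} {T : ℝ}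

theorem sub (hy : IsImpulsiveSolution a tk P f y T) (hx : IsImpulsiveSolution a tk R h x T)
    {Q : ℕ → ℝ} (hQ : ∀ k, tk k > T →
      Q k * (y (tk k) - x (tk k)) = P k * y (tk k) - R k * x (tk k)) :
    IsImpulsiveSolution a tk Q (fun t => f t - h t) (fun t => y t - x t) T where
  left_cont t ht := (hy.left_cont t ht).sub (hx.left_cont t ht)
  cont t ht hk := (hy.cont t ht hk).sub (hx.cont t ht hk)
  deriv t ht hk := ((hy.deriv t ht hk).sub (hx.deriv t ht hk)).congr_deriv (by ring)
  jump k hk := by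
    simp only [hQ k hk]
    exact (hy.jump k hk).sub (hx.jump k hk)

/-- The quantitative form of `normalized_le_cumulative`, in terms of the periodic function `x`. -/
theorem le_mul_of_nonpos (hy : IsImpulsiveSolution a tk P f y T)
    (hx : IsImpulsiveSolution a tk R h x 0)
    (D : ImpulseData ω p a tk α) (hp : 0 < p) (hα : ∏ k ∈ Finset.range p, α k = 1)
    (hP : ∀ k, 0 < P k) (hPα : ∀ k, P k ≤ α k)
    (hRper : ∀ k, R (k + p) = R k) (hR : ∀ k, 0 < R k) (hRα : ∀ k, R k ≤ α k)
    (hxper : ∀ t, x (t + ω) = x t) (hx0 : ∀ t, 0 < x t) (hh : ∀ t > 0, 0 ≤ h t)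
    {B S : ℝ} (hB : 1 ≤ B) (hBR : (∏ k ∈ Finset.range p, R k)⁻¹ ≤ B) (hS : 0 ≤ S)
    (hSR : 1 - S ≤ ∏ k ∈ Finset.range p, R k)
    {ξ M : ℝ} {m : ℕ} (hm : 0 < m) (hT : ω ≤ T) (hξ : T < ξ) (hM : 0 ≤ M)
    (hf1 : ∀ r > ξ, f r ≤ M * h r)
    (hf2 : ∀ r > ξ + m * ω, (∀ s ∈ Ico (r - m * ω) r, 0 ≤ y s) → f r ≤ 0)
    (hyξ : y ξ ≤ 0) {t : ℝ} (ht : ξ ≤ t) :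
    y t ≤ M * (B ^ m * (1 - (Real.exp (∫ u in (0:ℝ)..ω, a u))⁻¹ ^ m) *
      (1 + (1 - (Real.exp (∫ u in (0:ℝ)..ω, a u))⁻¹)⁻¹ * S)) * x t := by
  set Z := Real.exp (∫ u in (0:ℝ)..ω, a u) with hZ
  have hZ1 : 1 < Z := Real.one_lt_exp_iff.2 D.integral_pos
  have hw : ∀ r, 0 < growthFactor a r / jumpProd tk α r := fun r =>
    div_pos (ImpulseData.growthFactor_pos r) (D.jumpProd_pos r)
  have hterm : ∀ k, 0 ≤ (1 - R k / α k) * normalized a tk α x (tk k) := fun k =>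
    mul_nonneg (sub_nonneg.2 ((div_le_one (D.α_pos k)).2 (hRα k))) (mul_pos (hx0 _) (hw _)).le
  set c := (∑ k ∈ Finset.range p, (1 - R k / α k) * normalized a tk α x (tk k)) / (Z - 1)
  have hc : (Z - 1) * c
      = ∑ k ∈ Finset.range p, (1 - R k / α k) * normalized a tk α x (tk k) :=
    mul_div_cancel₀ _ (by linarith)
  have hc0 : 0 ≤ c := div_nonneg (Finset.sum_nonneg fun k _ => hterm k) (by linarith)
  have hF : ∀ t > 0, 0 ≤ cumulative a tk α R x c t := fun t _ =>
    add_nonneg (add_nonneg (mul_pos (hx0 _) (hw _)).le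
      (Finset.sum_nonneg fun k _ => hterm k)) hc0
  have h1 := hy.normalized_le_cumulative hx D hp hα hP hPα hRper hxper hc hh hF
    (D.ω_pos.le.trans hT) hξ hM hf1 hf2 hyξ ht
  have h2 := hx.cumulative_le_normalized D hp hα hRper hR hRα hxper hh hc
    (t := t - ω) (by linarith)
  rw [sub_add_cancel] at h2
  have hρ0 : 0 < ∏ k ∈ Finset.range p, R k := Finset.prod_pos fun k _ => hR k
  have hρ1 : ∏ k ∈ Finset.range p, R k ≤ 1 :=
    hα ▸ Finset.prod_le_prod (fun k _ => (hR k).le) fun k _ => hRα k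
  have h3 := pow_sub_one_mul_le hm hZ1 hB hS (mul_pos (hx0 t) (hw t)).le h2
    (inv_sub_inv_le_of_prod hZ1 hρ0 hρ1 hBR hSR)
  rw [← hZ] at h1
  have h4 := h1.trans (mul_le_mul_of_nonneg_left h3 hM)
  refine le_of_mul_le_mul_left ?_ (mul_pos (pow_pos (zero_lt_one.trans hZ1) m) (hw t))
  unfold normalized at h4
  linarith

end IsImpulsiveSolution

theorem IsPosSolLW.isImpulsiveSolution {n : ℕ} {a : ℝ → ℝ} {b β τi : Fin (n + 1) → ℝ → ℝ}
    {tk : ℕ → ℝ} {I : ℕ → ℝ → ℝ} {N : ℝ → ℝ} (h : IsPosSolLW a b β τi tk I 0 N) :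
    IsImpulsiveSolution a tk (fun k => 1 + I k (N (tk k)) / N (tk k))
      (fun t => ∑ i, b i t * Real.exp (-(β i t * N (t - τi i t)))) N 0 := by
  obtain ⟨-, -, hpos, hl, -, hc, hd, he, hj⟩ := h
  refine ⟨hl, hc, fun t ht hk => ?_, fun k hk => ?_⟩
  · refine (hd t ht).hasDerivWithinAt.congr_deriv ?_
    simp only [← he t ht hk]
    ring
  · have h0 := (hpos _ hk).ne'
    have h1 : (1 + I k (N (tk k)) / N (tk k)) * N (tk k) = N (tk k) + I k (N (tk k)) := by
      field_simp
    rw [h1]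
    exact hj k hk

/-- The forcing term of the difference of two solutions is controlled from above. -/
theorem sum_exp_neg_sub_le {ι : Type*} [Fintype ι] {b β N : ι → ℝ} {X v s : ℝ} (hv0 : 0 ≤ v)
    (hv1 : v ≤ 1) (hb : ∀ i, 0 < b i) (hβ : ∀ i, 0 < β i) (hs : ∀ i, β i * X ≤ s)
    (hN : ∀ i, -(v * X) ≤ N i - X) :
    ∑ i, b i * Real.exp (-(β i * N i)) - ∑ i, b i * Real.exp (-(β i * X)) ≤
      v * (Real.exp s - 1) * ∑ i, b i * Real.exp (-(β i * X)) := by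
  rw [← Finset.sum_sub_distrib, Finset.mul_sum]
  refine Finset.sum_le_sum fun i _ => ?_
  have := mul_le_mul_of_nonneg_left (exp_neg_sub_le hv0 hv1 (hβ i) (hs i) (hN i)) (hb i).le
  linarith

/-- The forcing term of the difference of two solutions is controlled from below. -/
theorem sum_exp_neg_sub_ge {ι : Type*} [Fintype ι] {b β N : ι → ℝ} {X u s : ℝ} (hu : 0 ≤ u)
    (hb : ∀ i, 0 < b i) (hβ : ∀ i, 0 < β i) (hs : ∀ i, β i * X ≤ s)
    (hN : ∀ i, N i - X ≤ u * X) :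
    -(∑ i, b i * Real.exp (-(β i * N i)) - ∑ i, b i * Real.exp (-(β i * X))) ≤
      u * s * ∑ i, b i * Real.exp (-(β i * X)) := by
  rw [neg_le, ← Finset.sum_sub_distrib, Finset.mul_sum, ← Finset.sum_neg_distrib]
  refine Finset.sum_le_sum fun i _ => ?_
  have := mul_le_mul_of_nonneg_left (exp_neg_sub_ge hu (hβ i) (hs i) (hN i)) (hb i).le
  linarith

theorem mul_lt_one_of_mul_sqrt_lt_one {β X E K : ℝ} (hβ : 0 ≤ β) (hX : 0 ≤ X) (hE : 0 ≤ E)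
    (hK : 0 ≤ K) (h : K * Real.sqrt (β * X * E) < 1) : E * K * (β * X * K) < 1 := by
  have hq : 0 ≤ β * X * E := by positivity
  have h1 := Real.sq_sqrt hq
  have h2 : 0 ≤ K * Real.sqrt (β * X * E) := by positivity
  have h3 : (K * Real.sqrt (β * X * E)) ^ 2 < 1 := pow_lt_one₀ h2 h two_ne_zero
  rw [mul_pow, h1] at h3
  linarith

theorem theorem33_LW_constant_delays {n : ℕ}
    (ω : ℝ) (hω : 0 < ω) (p : ℕ) (hp : 0 < p)
    (a : ℝ → ℝ) (b β τi : Fin (n + 1) → ℝ → ℝ) (tk : ℕ → ℝ) (I : ℕ → ℝ → ℝ)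
    -- constant delays τ_i(t) ≡ m_i ω
    (m : Fin (n + 1) → ℕ) (hm : ∀ i, 0 < m i)
    (hτconst : ∀ i t, τi i t = (m i : ℝ) * ω)
    -- (f₀)
    (ha : Continuous a ∧ (∀ t, 0 < a t) ∧ Function.Periodic a ω)
    (hb : ∀ i, Continuous (b i) ∧ (∀ t, 0 < b i t) ∧ Function.Periodic (b i) ω)
    (hβ : ∀ i, Continuous (β i) ∧ (∀ t, 0 < β i t) ∧ Function.Periodic (β i) ω)
    -- (i₀)
    (htk_mono : StrictMono tk) (htk0 : ∀ k < p, 0 < tk k ∧ tk k < ω)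
    (htk_per : ∀ k, tk (k + p) = tk k + ω)
    (hI_cont : ∀ k, ContinuousOn (I k) (Set.Ici 0))
    (hI_pos : ∀ k, ∀ u > (0:ℝ), 0 < u + I k u)
    (hI_per : ∀ k, I (k + p) = I k)
    (hI_zero : ∀ k, I k 0 = 0)
    -- (i₁), with (a_k), (b_k) extended p-periodically
    (aa bb : ℕ → ℝ) (haa_per : ∀ k, aa (k + p) = aa k) (hbb_per : ∀ k, bb (k + p) = bb k)
    (hbb : ∀ k, -1 < bb k)
    (hi1 : ∀ k, ∀ x y : ℝ, 0 ≤ x → 0 ≤ y → x ≠ y →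
      bb k ≤ (I k x - I k y) / (x - y) ∧ (I k x - I k y) / (x - y) ≤ aa k)
    -- (i₂)
    (hi2 : ∏ k ∈ Finset.range p, (1 + aa k) ≤ 1)
    -- the positive ω-periodic solution
    (Nstar : ℝ → ℝ) (hNstar : IsPosSolLW a b β τi tk I 0 Nstar)
    (hNper : ∀ t, Nstar (t + ω) = Nstar t)
    -- condition (3.8)
    (hcond :
      Bconst p hp bb ^ (Finset.univ.sup' Finset.univ_nonempty m) *
      Real.sqrt
        (sSup {x : ℝ | ∃ i : Fin (n + 1), ∃ t ∈ Set.Icc (0:ℝ) ω, β i t = x} *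
         sSup (Nstar '' Set.Icc (0:ℝ) ω) *
         (Real.exp
            (sSup {x : ℝ | ∃ i : Fin (n + 1), ∃ t ∈ Set.Icc (0:ℝ) ω,
              β i t * Nstar t = x}) - 1)) *
      (1 - Real.exp (-((Finset.univ.sup' Finset.univ_nonempty m : ℕ) : ℝ) *
          ∫ u in (0:ℝ)..ω, a u)) *
      (1 - (1 - Real.exp (-(∫ u in (0:ℝ)..ω, a u)))⁻¹ *
          ∑ k ∈ Finset.range p, min (bb k) 0) < 1) :
    -- N* attracts every positive solution
    ∀ N : ℝ → ℝ, IsPosSolLW a b β τi tk I 0 N →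
      Tendsto (fun t => N t - Nstar t) atTop (nhds 0) := by
  intro N hN
  obtain ⟨ha_cont, ha_pos, ha_per⟩ := ha
  have hx0 : ∀ t, 0 < Nstar t := by
    have hper : Function.Periodic Nstar ω := hNper
    intro t
    obtain ⟨s, hs, hst⟩ := hper.exists_mem_Ioc hω t 0
    rw [hst]
    exact hNstar.2.2.1 s hs.1
  have hxτ : ∀ i t, Nstar (t - τi i t) = Nstar t := fun i t => by
    rw [hτconst]
    exact Function.Periodic.sub_nat_mul_eq hNper (m i)
  have htk_pos : ∀ k, 0 < tk k := fun k =>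
    (htk0 0 hp).1.trans_le (htk_mono.monotone (Nat.zero_le k))
  obtain ⟨C, hC⟩ : ∃ C, ∀ t, Nstar t ≤ C := by
    obtain ⟨C, hC⟩ := bddAbove_image_of_one_sided_limits (x := Nstar)
      (isCompact_Icc (a := ω) (b := ω + ω))
      (fun t ht => hNstar.2.2.2.1 t (hω.trans_le ht.1))
      (fun t ht => hNstar.2.2.2.2.1 t (hω.trans_le ht.1))
    refine ⟨C, fun t => ?_⟩
    obtain ⟨s, hs, hst⟩ := Function.Periodic.exists_mem_Ico hNper hω t ω
    rw [hst]
    exact hC ⟨s, Ico_subset_Icc_self hs, rfl⟩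
  obtain ⟨Cβ, hCβ0, hCβ⟩ := exists_le_of_periodic_family hω (fun i => (hβ i).1)
    (fun i => (hβ i).2.2)
  have hβle := le_sSup_of_periodic hω (fun i => (hβ i).2.2) hCβ
  have hβxle := le_sSup_of_periodic (g := fun i t => β i t * Nstar t) (C := Cβ * C) hω
    (fun i => (hβ i).2.2.mul hNper)
    (fun i t => mul_le_mul (hCβ i t) (hC t) (hx0 t).le hCβ0)
  have hxle : ∀ t, Nstar t ≤ sSup (Nstar '' Set.Icc (0:ℝ) ω) := by
    intro t
    obtain ⟨s, hs, hst⟩ := Function.Periodic.exists_mem_Ico₀ hNper hω t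
    rw [hst]
    refine le_csSup ⟨C, ?_⟩ ⟨s, Ico_subset_Icc_self hs, rfl⟩
    rintro _ ⟨r, _, rfl⟩
    exact hC r
  set βs := sSup {x : ℝ | ∃ i : Fin (n + 1), ∃ t ∈ Set.Icc (0:ℝ) ω, β i t = x}
  set xs := sSup (Nstar '' Set.Icc (0:ℝ) ω)
  set βxs := sSup {x : ℝ | ∃ i : Fin (n + 1), ∃ t ∈ Set.Icc (0:ℝ) ω, β i t * Nstar t = x}
  set mbar := Finset.univ.sup' Finset.univ_nonempty m
  set Bc := Bconst p hp bb
  have hβs : 0 ≤ βs := ((hβ 0).2.1 0).le.trans (hβle 0 0)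
  have hxs : 0 ≤ xs := (hx0 0).le.trans (hxle 0)
  have hE0 : 0 ≤ Real.exp βxs - 1 := sub_nonneg.2 (Real.one_le_exp
    ((mul_pos ((hβ 0).2.1 0) (hx0 0)).le.trans (hβxle 0 0)))
  have hmle : ∀ i, m i ≤ mbar := fun i => Finset.le_sup' m (Finset.mem_univ i)
  have hmbar : 0 < mbar := (hm 0).trans_le (hmle 0)
  have hab : ∀ k, bb k ≤ aa k := fun k => by
    have := hi1 k 1 0 zero_le_one le_rfl one_ne_zero
    exact this.1.trans this.2
  obtain ⟨α, haα, hα_per, hα⟩ := exists_scaled_prod_eq_one p hp (fun k => 1 + aa k)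
    (fun k => by linarith [hab k, hbb k]) (fun k => by simp only [haa_per]) hi2
  have D : ImpulseData ω p a tk α := ⟨hω, ha_cont, ha_per, ha_pos, htk_mono, htk0, htk_per,
    fun k => by linarith [hab k, hbb k, haα k], hα_per⟩
  set R : ℕ → ℝ := fun k => 1 + I k (Nstar (tk k)) / Nstar (tk k) with hRdef
  have hRb : ∀ k, 1 + bb k ≤ R k ∧ R k ≤ 1 + aa k := fun k => by
    have := hi1 k (Nstar (tk k)) 0 (hx0 _).le le_rfl (hx0 _).ne'
    simp only [hI_zero, sub_zero] at this
    exact ⟨by simp only [hRdef]; linarith [this.1], by simp only [hRdef]; linarith [this.2]⟩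
  have hRper : ∀ k, R (k + p) = R k := fun k => by
    simp only [hRdef, hI_per, htk_per, hNper]
  set P : ℕ → ℝ := fun k => if N (tk k) = Nstar (tk k) then α k else
    1 + (I k (N (tk k)) - I k (Nstar (tk k))) / (N (tk k) - Nstar (tk k)) with hPdef
  have hN0 : ∀ t > 0, 0 < N t := hN.2.2.1
  have hPb : ∀ k, 0 < P k ∧ P k ≤ α k := fun k => by
    simp only [hPdef]
    split_ifs with hk
    · exact ⟨D.α_pos k, le_rfl⟩
    · have := hi1 k (N (tk k)) (Nstar (tk k)) (hN0 _ (htk_pos k)).le (hx0 _).le hk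
      exact ⟨by linarith [hbb k, this.1], by linarith [haα k, this.2]⟩
  have hx : IsImpulsiveSolution a tk R
      (fun t => ∑ i, b i t * Real.exp (-(β i t * Nstar t))) Nstar 0 := by
    simpa only [hxτ] using hNstar.isImpulsiveSolution
  have hy := (hN.isImpulsiveSolution.sub hx (Q := P) fun k hk => by
    have h1 := (hN0 _ hk).ne'
    have h2 := (hx0 (tk k)).ne'
    simp only [hPdef, hRdef]
    split_ifs with h
    · simp [h]
    · have h3 := sub_ne_zero.2 h
      field_simp
      ring).mono (T' := mbar * ω) (by positivity)
  have hh : ∀ t > 0, 0 ≤ ∑ i, b i t * Real.exp (-(β i t * Nstar t)) := fun t _ =>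
    Finset.sum_nonneg fun i _ => mul_nonneg ((hb i).2.1 t).le (Real.exp_pos _).le
  have hprod0 : 0 < ∏ k ∈ Finset.range p, (1 + bb k) :=
    Finset.prod_pos fun k _ => by linarith [hbb k]
  have hprodR : ∏ k ∈ Finset.range p, (1 + bb k) ≤ ∏ k ∈ Finset.range p, R k :=
    Finset.prod_le_prod (fun k _ => by linarith [hbb k]) fun k _ => (hRb k).1
  have hBc := inv_prod_le_Bconst p hp bb hbb_per
  have hBc1 : 1 ≤ Bc := le_trans ((one_le_inv₀ hprod0).2 ((Finset.prod_le_prod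
    (fun k _ => by linarith [hbb k]) fun k _ => by linarith [hab k]).trans hi2)) hBc
  have hBR : (∏ k ∈ Finset.range p, R k)⁻¹ ≤ Bc := (inv_anti₀ hprod0 hprodR).trans hBc
  set S := -∑ k ∈ Finset.range p, min (bb k) 0 with hSdef
  have hS : 0 ≤ S := neg_nonneg.2 (Finset.sum_nonpos fun k _ => min_le_right _ _)
  have hSR : 1 - S ≤ ∏ k ∈ Finset.range p, R k := by
    rw [hSdef, sub_neg_eq_add]
    exact (one_add_sum_min_le_prod bb hbb p).trans hprodR
  have hmω : ω ≤ mbar * ω := le_mul_of_one_le_left hω.le (by exact_mod_cast hmbar)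
  have hup := fun (ξ M : ℝ) => hy.le_mul_of_nonpos (ξ := ξ) (M := M) hx D hp hα
    (fun k => (hPb k).1) (fun k => (hPb k).2) hRper
    (fun k => by linarith [hbb k, (hRb k).1]) (fun k => (hRb k).2.trans (haα k)) hNper hx0 hh
    hBc1 hBR hS hSR hmbar hmω
  have hdown := fun (ξ M : ℝ) => hy.neg.le_mul_of_nonpos (ξ := ξ) (M := M) hx D hp hα
    (fun k => (hPb k).1) (fun k => (hPb k).2) hRper
    (fun k => by linarith [hbb k, (hRb k).1]) (fun k => (hRb k).2.trans (haα k)) hNper hx0 hh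
    hBc1 hBR hS hSR hmbar hmω
  set z := (Real.exp (∫ u in (0:ℝ)..ω, a u))⁻¹ with hz
  have hz0 : 0 ≤ z := (inv_pos.2 (Real.exp_pos _)).le
  have hz1 : z < 1 := inv_lt_one_of_one_lt₀ (Real.one_lt_exp_iff.2 D.integral_pos)
  set K := Bc ^ mbar * (1 - z ^ mbar) * (1 + (1 - z)⁻¹ * S) with hKdef
  have hK : 0 ≤ K := by
    have h1 : 0 ≤ 1 - z ^ mbar := sub_nonneg.2 (pow_le_one₀ hz0 hz1.le)
    have h2 : 0 < 1 - z := sub_pos.2 hz1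
    positivity
  have hcontr : (Real.exp βxs - 1) * K * (βs * xs * K) < 1 := by
    refine mul_lt_one_of_mul_sqrt_lt_one hβs hxs hE0 hK (lt_of_eq_of_lt ?_ hcond)
    have hzm : Real.exp (-((mbar : ℕ) : ℝ) * ∫ u in (0:ℝ)..ω, a u) = z ^ mbar := by
      rw [hz, ← Real.exp_neg, ← Real.exp_nat_mul]
      ring_nf
    rw [hzm, Real.exp_neg, ← hz, hKdef, hSdef]
    ring
  have hxm : ∀ i r, Nstar (r - m i * ω) = Nstar r := fun i r => by rw [← hτconst i r, hxτ]
  have hlag : ∀ (i) (r : ℝ), r - m i * ω ∈ Ico (r - mbar * ω) r := fun i r => by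
    have h1 : (m i : ℝ) * ω ≤ mbar * ω :=
      mul_le_mul_of_nonneg_right (by exact_mod_cast hmle i) hω.le
    have h2 : 0 < (m i : ℝ) * ω := mul_pos (by exact_mod_cast hm i) hω
    exact ⟨by linarith, by linarith⟩
  have hfle : ∀ v r : ℝ, 0 ≤ v → v ≤ 1 →
      (∀ s ∈ Ico (r - mbar * ω) r, -(v * Nstar s) ≤ N s - Nstar s) →
      ∑ i, b i r * Real.exp (-(β i r * N (r - τi i r))) -
        ∑ i, b i r * Real.exp (-(β i r * Nstar r)) ≤
      v * (Real.exp βxs - 1) * ∑ i, b i r * Real.exp (-(β i r * Nstar r)) :=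
    fun v r hv0 hv1 hs => sum_exp_neg_sub_le hv0 hv1 (fun i => (hb i).2.1 r)
      (fun i => (hβ i).2.1 r) (fun i => hβxle i r) fun i => by
        simpa only [hxm, ← hτconst i r, hxτ] using hs _ (hlag i r)
  have hfge : ∀ u r : ℝ, 0 ≤ u → (∀ s ∈ Ico (r - mbar * ω) r, N s - Nstar s ≤ u * Nstar s) →
      -(∑ i, b i r * Real.exp (-(β i r * N (r - τi i r))) -
        ∑ i, b i r * Real.exp (-(β i r * Nstar r))) ≤
      u * (βs * xs) * ∑ i, b i r * Real.exp (-(β i r * Nstar r)) :=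
    fun u r hu hs => sum_exp_neg_sub_ge hu (fun i => (hb i).2.1 r)
      (fun i => (hβ i).2.1 r) (fun i => mul_le_mul (hβle i r) (hxle r) (hx0 r).le hβs)
      fun i => by simpa only [hxm, ← hτconst i r, hxτ] using hs _ (hlag i r)
  have hfpos : ∀ r, (∀ s ∈ Ico (r - mbar * ω) r, 0 ≤ N s - Nstar s) →
      ∑ i, b i r * Real.exp (-(β i r * N (r - τi i r))) -
        ∑ i, b i r * Real.exp (-(β i r * Nstar r)) ≤ 0 := fun r hs => by
    simpa only [zero_mul] using hfle 0 r le_rfl zero_le_one (by simpa using hs)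
  have hfneg : ∀ r, (∀ s ∈ Ico (r - mbar * ω) r, N s - Nstar s ≤ 0) →
      0 ≤ ∑ i, b i r * Real.exp (-(β i r * N (r - τi i r))) -
        ∑ i, b i r * Real.exp (-(β i r * Nstar r)) := fun r hs => by
    simpa only [zero_mul, neg_nonpos] using hfge 0 r le_rfl (by simpa using hs)
  refine hy.tendsto_zero_of_contraction D hp hα (fun k => (hPb k).2) (x := Nstar)
    (L := mbar * ω) (mul_nonneg hE0 hK) (mul_nonneg (mul_nonneg hβs hxs) hK) hcontr
    (fun t => ⟨hx0 t, hC t⟩) (hω.le.trans hmω)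
    (fun t ht => by linarith [hN0 t (hω.trans_le (hmω.trans ht))])
    (fun t _ => hfpos t) (fun t _ => hfneg t) ?_ ?_
  · intro v S ξ hv0 hv1 hTS hSξ hv hyξ t ht
    rw [← mul_assoc]
    exact hup ξ (v * (Real.exp βxs - 1)) (by linarith) (mul_nonneg hv0 hE0)
      (fun r hr => hfle v r hv0 hv1 fun s hs => hv s (by linarith [hs.1]))
      (fun r _ => hfpos r) hyξ ht
  · intro u S ξ hu0 hTS hSξ hu hyξ t ht
    rw [← mul_assoc, neg_le]
    exact hdown ξ (u * (βs * xs)) (by linarith) (mul_nonneg hu0 (mul_nonneg hβs hxs))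
      (fun r hr => hfge u r hu0 fun s hs => hu s (by linarith [hs.1]))
      (fun r _ hs => neg_nonpos.2 (hfneg r fun s h => neg_nonneg.1 (hs s h)))
      (neg_nonpos.2 hyξ) ht
end
end

section
/- Consider the (non-impulsive) delay differential equation N′(t) + a(t)N(t) = b(t)·e^{−N(t−mω)} for t ≥ 0, where ω > 0, m is a positive integer, and a, b are positive, continuous, ω-periodic functions on ℝ. Let N* be a positive ω-periodic solution and set N̄* := max_{t∈[0,ω]} N*(t). If N̄* · (1 − e^{−m·∫₀^ω a(u)du}) · e^{−m·∫₀^ω a(u)du} · sup_{t∈[0,ω]} ∫₀^{mω} b(t+s)·e^{∫_t^{t+s} a(u)du} ds < 1, then N* attracts all positive solutions: every positive solution N on [0,∞) satisfies N(t) − N*(t) → 0 as t → ∞. -/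
open Filter Set

noncomputable section

/-- A positive solution on `[0,∞)` of `N′(t) + a(t)N(t) = b(t)e^{−N(t−mω)}`. -/
def IsPosSolWazewska (ω : ℝ) (m : ℕ) (a b : ℝ → ℝ) (N : ℝ → ℝ) : Prop :=
  ContinuousOn N (Set.Ici (-((m : ℝ) * ω))) ∧
  (∀ t ≥ -((m : ℝ) * ω), 0 < N t) ∧
  (∀ t > (0:ℝ),
    HasDerivAt N (b t * Real.exp (-N (t - (m : ℝ) * ω)) - a t * N t) t)

/-- One-sided estimate for a scalar linear equation `x' = g - a x` in which the forcing `g` opposes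
the sign of the delayed value `x (t - τ)` and is dominated by `c v`. The function `A` is an
antiderivative of `a` and `P` is an antiderivative of `c e^A`. -/
lemma eventually_le_of_delayed_feedback {a A x g c P : ℝ → ℝ} {τ T v α ε : ℝ}
    (hτ : 0 < τ) (hv : 0 ≤ v) (hα : 0 ≤ α) (hε : 0 < ε)
    (hA : ∀ t, HasDerivAt A (a t) t) (ha : ∀ t, 0 ≤ a t) (hAtop : Tendsto A atTop atTop)
    (hx : ∀ t > T, HasDerivAt x (g t - a t * x t) t)
    (hg : ∀ t > T, 0 ≤ x (t - τ) → g t ≤ 0) (hgv : ∀ t > T, g t ≤ c t * v)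
    (hc : ∀ t > T, 0 ≤ c t) (hP : ∀ t > T, HasDerivAt P (c t * Real.exp (A t)) t)
    (hPα : ∀ t > T + τ, P t - P (t - τ) ≤ α * Real.exp (A t)) :
    ∀ᶠ t in atTop, x t ≤ α * v + ε := by
  have hAmono : Monotone A := monotone_of_hasDerivAt_nonneg hA ha
  have hw : ∀ t > T, HasDerivAt (fun t => x t * Real.exp (A t)) (g t * Real.exp (A t)) t := by
    intro t ht
    refine ((hx t ht).mul (hA t).exp).congr_deriv ?_
    ring
  have hanti : ∀ r > T, ∀ t, r ≤ t → (∀ s, r < s → s < t → 0 ≤ x (s - τ)) →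
      x t * Real.exp (A t) ≤ x r * Real.exp (A r) := by
    intro r hr t hrt hpos
    refine antitoneOn_of_hasDerivWithinAt_nonpos (f' := fun s => g s * Real.exp (A s))
      (convex_Icc r t)
      (fun s hs => (hw s (hr.trans_le hs.1)).continuousAt.continuousWithinAt) ?_ ?_
      (left_mem_Icc.2 hrt) (right_mem_Icc.2 hrt) hrt
    · intro s hs
      rw [interior_Icc] at hs
      exact (hw s (hr.trans hs.1)).hasDerivWithinAt
    · intro s hs
      rw [interior_Icc] at hs
      exact mul_nonpos_of_nonpos_of_nonneg (hg s (hr.trans hs.1) (hpos s hs.1 hs.2))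
        (Real.exp_pos _).le
  have hPmono : MonotoneOn P (Ioi T) := by
    refine monotoneOn_of_hasDerivWithinAt_nonneg (f' := fun s => c s * Real.exp (A s))
      (convex_Ioi T) (fun s hs => (hP s hs).continuousAt.continuousWithinAt) ?_ ?_
    · intro s hs
      rw [interior_Ioi] at hs
      exact (hP s hs).hasDerivWithinAt
    · intro s hs
      rw [interior_Ioi] at hs
      exact mul_nonneg (hc s hs) (Real.exp_pos _).le
  have hdom : AntitoneOn (fun t => x t * Real.exp (A t) - P t * v) (Ioi T) := by
    have hd : ∀ t > T, HasDerivAt (fun t => x t * Real.exp (A t) - P t * v)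
        (g t * Real.exp (A t) - c t * Real.exp (A t) * v) t :=
      fun t ht => (hw t ht).sub ((hP t ht).mul_const v)
    refine antitoneOn_of_hasDerivWithinAt_nonpos
      (f' := fun t => g t * Real.exp (A t) - c t * Real.exp (A t) * v)
      (convex_Ioi T) (fun s hs => (hd s hs).continuousAt.continuousWithinAt) ?_ ?_
    · intro s hs
      rw [interior_Ioi] at hs
      exact (hd s hs).hasDerivWithinAt
    · intro s hs
      rw [interior_Ioi] at hs
      nlinarith [mul_le_mul_of_nonneg_right (hgv s hs) (Real.exp_pos (A s)).le]
  have hshort : ∀ ξ > T, ∀ t > T + τ, ξ ≤ t → t ≤ ξ + τ → x ξ ≤ 0 → x t ≤ α * v := by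
    intro ξ hξ t ht hξt htξ hxξ
    have h1 := hdom hξ (show t ∈ Ioi T from hξ.trans_le hξt) hξt
    have h2 := hPmono (show t - τ ∈ Ioi T from by simp only [mem_Ioi]; linarith) hξ
      (show t - τ ≤ ξ by linarith)
    have h3 := mul_le_mul_of_nonneg_right (hPα t ht) hv
    have h4 := mul_le_mul_of_nonneg_right h2 hv
    have h5 := mul_nonpos_of_nonpos_of_nonneg hxξ (Real.exp_pos (A ξ)).le
    simp only at h1
    refine le_of_mul_le_mul_right ?_ (Real.exp_pos (A t))
    linarith
  by_cases hex : ∃ ξ₀ > T + τ, x ξ₀ ≤ 0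
  · obtain ⟨ξ₀, hξ₀, hxξ₀⟩ := hex
    filter_upwards [eventually_ge_atTop ξ₀] with t ht
    suffices h : x t ≤ α * v by linarith
    have hcont : ContinuousOn x (Icc ξ₀ t) := fun s hs =>
      (hx s (by linarith [hs.1])).continuousAt.continuousWithinAt
    have hcomp : IsCompact (Icc ξ₀ t ∩ x ⁻¹' Iic 0) :=
      isCompact_Icc.of_isClosed_subset
        (hcont.preimage_isClosed_of_isClosed isClosed_Icc isClosed_Iic) inter_subset_left
    obtain ⟨ξ, ⟨⟨hξ₀ξ, hξt⟩, hxξ⟩, hmax⟩ :=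
      hcomp.exists_isGreatest ⟨ξ₀, left_mem_Icc.2 ht, hxξ₀⟩
    rcases le_or_gt t (ξ + τ) with hle | hgt
    · exact hshort ξ (by linarith) t (by linarith) hξt hle hxξ
    · have h1 := hanti (ξ + τ) (by linarith) t hgt.le (by
        intro s hs hst
        by_contra! hneg
        have : s - τ ≤ ξ := hmax ⟨⟨by linarith, by linarith⟩, hneg.le⟩
        linarith)
      have h2 := hshort ξ (by linarith) (ξ + τ) (by linarith) (by linarith) le_rfl hxξ
      have h3 : Real.exp (A (ξ + τ)) ≤ Real.exp (A t) := Real.exp_le_exp.2 (hAmono hgt.le)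
      refine le_of_mul_le_mul_right ?_ (Real.exp_pos (A t))
      calc x t * Real.exp (A t) ≤ x (ξ + τ) * Real.exp (A (ξ + τ)) := h1
        _ ≤ α * v * Real.exp (A (ξ + τ)) :=
          mul_le_mul_of_nonneg_right h2 (Real.exp_pos _).le
        _ ≤ α * v * Real.exp (A t) := mul_le_mul_of_nonneg_left h3 (mul_nonneg hα hv)
  · push Not at hex
    set r := T + 2 * τ + 1
    have hlim : Tendsto (fun t => x r * Real.exp (A r) * Real.exp (-A t)) atTop (nhds 0) := by
      simpa using (Real.tendsto_exp_neg_atTop_nhds_zero.comp hAtop).const_mul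
        (x r * Real.exp (A r))
    filter_upwards [hlim.eventually_lt_const hε, eventually_ge_atTop r] with t hlt htr
    have h1 := hanti r (by linarith) t htr fun s hs _ => (hex _ (by linarith)).le
    have h2 : x t ≤ x r * Real.exp (A r) * Real.exp (-A t) := by
      rw [Real.exp_neg, ← div_eq_mul_inv, le_div_iff₀ (Real.exp_pos _)]
      exact h1
    nlinarith [mul_nonneg hα hv]

/-- If eventual lower bounds give eventual upper bounds with gain `α`, eventual upper bounds give
eventual lower bounds with gain `β`, and `α β < 1`, then a function bounded below tends to zero. -/
lemma tendsto_zero_of_gain_lt_one {x : ℝ → ℝ} {α β v₀ : ℝ} (hα : 0 ≤ α) (hβ : 0 ≤ β)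
    (hαβ : α * β < 1) (hv₀ : 0 ≤ v₀) (hx₀ : ∀ᶠ t in atTop, -v₀ ≤ x t)
    (hup : ∀ v ≥ 0, (∀ᶠ t in atTop, -v ≤ x t) → ∀ ε > 0, ∀ᶠ t in atTop, x t ≤ α * v + ε)
    (hlow : ∀ u ≥ 0, (∀ᶠ t in atTop, x t ≤ u) → ∀ ε > 0, ∀ᶠ t in atTop, -(β * u + ε) ≤ x t) :
    Tendsto x atTop (nhds 0) := by
  set V := {v : ℝ | 0 ≤ v ∧ ∀ᶠ t in atTop, -v ≤ x t}
  have hne : V.Nonempty := ⟨v₀, hv₀, hx₀⟩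
  have hbdd : BddBelow V := ⟨0, fun v hv => hv.1⟩
  have hinf0 : 0 ≤ sInf V := Real.sInf_nonneg fun v hv => hv.1
  have hstep : ∀ v ∈ V, ∀ ε > 0, sInf V ≤ α * β * v + (β + 1) * ε := by
    intro v hv ε hε
    refine csInf_le hbdd ⟨by have := hv.1; positivity, ?_⟩
    have := hlow (α * v + ε) (by have := hv.1; positivity) (hup v hv.1 hv.2 ε hε) ε hε
    convert this using 3
    ring
  have hstep' : ∀ v ∈ V, sInf V ≤ α * β * v := by
    intro v hv
    refine le_of_forall_pos_le_add fun δ hδ => ?_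
    have := hstep v hv (δ / (β + 1)) (by positivity)
    rwa [mul_div_cancel₀ _ (by positivity)] at this
  have hinf : sInf V = 0 := by
    refine le_antisymm ?_ hinf0
    have hk : 0 ≤ α * β := mul_nonneg hα hβ
    have : sInf V ≤ α * β * sInf V := by
      refine le_of_forall_pos_le_add fun δ hδ => ?_
      obtain ⟨v, hv, hvδ⟩ := exists_lt_of_csInf_lt hne (lt_add_of_pos_right (sInf V) hδ)
      nlinarith [hstep' v hv, mul_le_mul_of_nonneg_left hvδ.le hk]
    nlinarith
  rw [Metric.tendsto_nhds]
  intro ε hε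
  obtain ⟨v, hv, hvδ⟩ := exists_lt_of_csInf_lt hne
    (show sInf V < ε / (2 * (α + 1)) by rw [hinf]; positivity)
  have h1 : v * (2 * (α + 1)) < ε := (lt_div_iff₀ (by positivity)).1 hvδ
  have hv0 := hv.1
  have hαv := mul_nonneg hα hv0
  filter_upwards [hv.2, hup v hv.1 hv.2 (ε / 2) (by positivity)] with t h2 h3
  rw [Real.dist_eq, sub_zero, abs_lt]
  constructor <;> nlinarith

lemma Function.Periodic.le_sSup_image_Icc {f : ℝ → ℝ} {ω : ℝ} (hf : Function.Periodic f ω)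
    (hω : 0 < ω) (hcont : ContinuousOn f (Icc 0 ω)) (t : ℝ) : f t ≤ sSup (f '' Icc 0 ω) := by
  obtain ⟨s, hs, hst⟩ := hf.exists_mem_Ico₀ hω t
  rw [hst]
  exact le_csSup (isCompact_Icc.image_of_continuousOn hcont).bddAbove
    (mem_image_of_mem f (Ico_subset_Icc_self hs))

theorem corollary32_wazewska_attractive
    (ω : ℝ) (hω : 0 < ω) (m : ℕ) (hm : 0 < m)
    (a b : ℝ → ℝ)
    (ha : Continuous a ∧ (∀ t, 0 < a t) ∧ Function.Periodic a ω)
    (hb : Continuous b ∧ (∀ t, 0 < b t) ∧ Function.Periodic b ω)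
    -- the positive ω-periodic solution
    (Nstar : ℝ → ℝ) (hNstar : IsPosSolWazewska ω m a b Nstar)
    (hNper : ∀ t, Nstar (t + ω) = Nstar t)
    -- the smallness condition
    (hcond :
      sSup (Nstar '' Set.Icc (0:ℝ) ω) *
      (1 - Real.exp (-(m : ℝ) * ∫ u in (0:ℝ)..ω, a u)) *
      Real.exp (-(m : ℝ) * ∫ u in (0:ℝ)..ω, a u) *
      sSup ((fun t : ℝ => ∫ s in (0:ℝ)..((m : ℝ) * ω),
          b (t + s) * Real.exp (∫ u in t..(t + s), a u)) '' Set.Icc (0:ℝ) ω) < 1) :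
    -- N* attracts all positive solutions
    ∀ N : ℝ → ℝ, IsPosSolWazewska ω m a b N →
      Tendsto (fun t => N t - Nstar t) atTop (nhds 0) := by
  intro N hN
  obtain ⟨hac, hapos, haper⟩ := ha
  obtain ⟨hbc, hbpos, hbper⟩ := hb
  set τ : ℝ := (m : ℝ) * ω with hτdef
  have hm' : (0 : ℝ) < m := by exact_mod_cast hm
  have hτ : 0 < τ := mul_pos hm' hω
  set I : ℝ := ∫ u in (0:ℝ)..ω, a u
  have hIpos : 0 < I := intervalIntegral.intervalIntegral_pos_of_pos
    (hac.intervalIntegrable _ _) hapos hω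
  set q : ℝ := Real.exp (-(m : ℝ) * I) with hq
  have hq0 : 0 < q := Real.exp_pos _
  have hq1 : q < 1 := Real.exp_lt_one_iff.2 (by nlinarith)
  set A : ℝ → ℝ := fun t => ∫ u in (0:ℝ)..t, a u
  have hA : ∀ t, HasDerivAt A (a t) t := fun t =>
    (hac.integral_hasStrictDerivAt 0 t).hasDerivAt
  have hAcont : Continuous A := continuous_iff_continuousAt.2 fun t => (hA t).continuousAt
  have hAsub : ∀ s t, ∫ u in s..t, a u = A t - A s := fun s t =>
    (intervalIntegral.integral_interval_sub_left (hac.intervalIntegrable _ _)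
      (hac.intervalIntegrable _ _)).symm
  have hAtop : Tendsto A atTop atTop :=
    haper.tendsto_atTop_intervalIntegral_of_pos' (hac.intervalIntegrable _ _)
      hapos hω
  have hAτ : ∀ t, A t - A (t - τ) = m * I := by
    intro t
    rw [← hAsub]
    have h := haper.intervalIntegral_add_zsmul_eq (m : ℤ) (t - τ)
      (fun _ _ => hac.intervalIntegrable _ _)
    simp only [natCast_zsmul, nsmul_eq_mul, ← hτdef, sub_add_cancel] at h
    rw [h, haper.intervalIntegral_add_eq (t - τ) 0, zero_add]
  have hqexp : ∀ t, Real.exp (A (t - τ)) = q * Real.exp (A t) := by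
    intro t
    rw [hq, ← Real.exp_add]
    congr 1
    linarith [hAτ t]
  have hNperiodic : Function.Periodic Nstar ω := hNper
  have hNτ : ∀ t, Nstar (t - τ) = Nstar t := fun t => hNperiodic.sub_nat_mul_eq m
  have hNle := hNperiodic.le_sSup_image_Icc hω
    (hNstar.1.mono fun t ht => by simp only [mem_Ici]; linarith [ht.1])
  set M := sSup (Nstar '' Icc 0 ω)
  have hNpos : ∀ t ≥ -τ, 0 < Nstar t := hNstar.2.1
  have hM : 0 < M := (hNpos 0 (by linarith)).trans_le (hNle 0)
  set F : ℝ → ℝ := fun t => ∫ s in (0:ℝ)..τ, b (t + s) * Real.exp (∫ u in t..(t + s), a u)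
    with hF
  have hFper : Function.Periodic F ω := by
    intro t
    simp only [hF]
    refine intervalIntegral.integral_congr fun s _ => ?_
    have h1 : ∫ u in (t + ω)..(t + ω + s), a u = ∫ u in t..(t + s), a u := by
      rw [show t + ω + s = t + s + ω by ring, ← intervalIntegral.integral_comp_add_right]
      simp only [haper _]
    simp only [h1]
    rw [show t + ω + s = t + s + ω by ring, hbper]
  have hFcont : Continuous F := by
    simp only [hF, hAsub]
    refine intervalIntegral.continuous_parametric_intervalIntegral_of_continuous' ?_ 0 τ
    simp only [Function.uncurry_def]
    fun_prop
  have hFle := hFper.le_sSup_image_Icc hω hFcont.continuousOn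
  set S := sSup (F '' Icc 0 ω)
  have hF0 : 0 ≤ F 0 := intervalIntegral.integral_nonneg hτ.le fun s _ =>
    mul_nonneg (hbpos _).le (Real.exp_pos _).le
  have hS : 0 ≤ S := hF0.trans (hFle 0)
  set P : ℝ → ℝ := fun t => ∫ s in (0:ℝ)..t, b s * Real.exp (A s) with hPdef
  have hbA : Continuous fun s => b s * Real.exp (A s) := by fun_prop
  have hP : ∀ t, HasDerivAt P (b t * Real.exp (A t)) t := fun t =>
    (hbA.integral_hasStrictDerivAt 0 t).hasDerivAt
  have hPF : ∀ t, P t - P (t - τ) ≤ q * S * Real.exp (A t) := by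
    intro t
    have h1 : P t - P (t - τ) = Real.exp (A (t - τ)) * F (t - τ) := by
      rw [hPdef, intervalIntegral.integral_interval_sub_left (hbA.intervalIntegrable _ _)
        (hbA.intervalIntegrable _ _)]
      simp only [hF]
      rw [← intervalIntegral.integral_const_mul]
      have h2 := intervalIntegral.integral_comp_add_left (a := 0) (b := τ)
        (fun s => b s * Real.exp (A s)) (t - τ)
      rw [add_zero, sub_add_cancel] at h2
      rw [← h2]
      refine intervalIntegral.integral_congr fun s _ => ?_
      simp only [hAsub]
      rw [mul_left_comm, ← Real.exp_add]
      ring_nf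
    rw [h1, hqexp]
    nlinarith [mul_le_mul_of_nonneg_left (hFle (t - τ)) (mul_pos hq0 (Real.exp_pos (A t))).le]
  have hNd : ∀ t > 0, HasDerivAt Nstar (b t * Real.exp (-Nstar t) - a t * Nstar t) t := by
    intro t ht
    have := hNstar.2.2 t ht
    rwa [← hτdef, hNτ] at this
  have hQ : ∀ t > 0, HasDerivAt (fun t => Nstar t * Real.exp (A t))
      (b t * Real.exp (-Nstar t) * Real.exp (A t)) t := by
    intro t ht
    refine ((hNd t ht).mul (hA t).exp).congr_deriv ?_
    ring
  have hQle : ∀ t, Nstar t * Real.exp (A t) - Nstar (t - τ) * Real.exp (A (t - τ)) ≤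
      M * (1 - q) * Real.exp (A t) := by
    intro t
    rw [hNτ, hqexp]
    have := mul_le_mul_of_nonneg_right (hNle t)
      (mul_pos (sub_pos.2 hq1) (Real.exp_pos (A t))).le
    linarith
  have hNtpos : ∀ t ≥ -τ, 0 < N t := hN.2.1
  have hx : ∀ t > 0, HasDerivAt (fun t => N t - Nstar t)
      (b t * (Real.exp (-N (t - τ)) - Real.exp (-Nstar t)) - a t * (N t - Nstar t)) t := by
    intro t ht
    refine ((hN.2.2 t ht).sub (hNd t ht)).congr_deriv ?_
    ring
  refine tendsto_zero_of_gain_lt_one (α := q * S) (β := M * (1 - q)) (v₀ := M)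
    (mul_nonneg hq0.le hS) (mul_nonneg hM.le (sub_pos.2 hq1).le) (by linarith) hM.le ?_ ?_ ?_
  · filter_upwards [eventually_ge_atTop 0] with t ht
    linarith [hNle t, hNtpos t (by linarith)]
  · intro v hv hev ε hε
    obtain ⟨T, hT⟩ := eventually_atTop.1 hev
    refine eventually_le_of_delayed_feedback (T := max T 0 + τ) (c := b) hτ hv
      (mul_nonneg hq0.le hS) hε hA (fun t => (hapos t).le) hAtop
      (fun t ht => hx t (by linarith [le_max_right T 0])) ?_ ?_ (fun t _ => (hbpos t).le)
      (fun t _ => hP t) (fun t _ => hPF t)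
    · intro t _ h
      rw [hNτ] at h
      exact mul_nonpos_of_nonneg_of_nonpos (hbpos t).le
        (sub_nonpos.2 (Real.exp_le_exp.2 (by linarith)))
    · intro t ht
      refine mul_le_mul_of_nonneg_left ?_ (hbpos t).le
      have h1 := hT (t - τ) (by linarith [le_max_left T 0])
      rw [hNτ] at h1
      have h2 := hNtpos (t - τ) (by linarith [le_max_right T 0])
      have h3 := Real.add_one_le_exp (N (t - τ) - Nstar t)
      have h4 : Real.exp (-Nstar t) =
          Real.exp (-N (t - τ)) * Real.exp (N (t - τ) - Nstar t) := by
        rw [← Real.exp_add]; ring_nf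
      have h5 : Real.exp (-N (t - τ)) ≤ 1 := Real.exp_le_one_iff.2 (by linarith)
      have h6 := Real.exp_pos (-N (t - τ))
      rw [h4]
      nlinarith [mul_le_mul_of_nonneg_left h3 h6.le]
  · intro u hu hev ε hε
    obtain ⟨T, hT⟩ := eventually_atTop.1 hev
    have := eventually_le_of_delayed_feedback (T := max T 0 + τ) (x := fun t => Nstar t - N t)
      (g := fun t => b t * (Real.exp (-Nstar t) - Real.exp (-N (t - τ))))
      (c := fun t => b t * Real.exp (-Nstar t)) hτ hu
      (mul_nonneg hM.le (sub_pos.2 hq1).le) hε hA (fun t => (hapos t).le) hAtop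
      (fun t ht => ?_) ?_ ?_ (fun t _ => (mul_pos (hbpos t) (Real.exp_pos _)).le)
      (fun t ht => hQ t (by linarith [le_max_right T 0])) (fun t _ => hQle t)
    · filter_upwards [this] with t ht
      linarith
    · have h0 : 0 < t := by linarith [le_max_right T 0]
      refine ((hNd t h0).sub (hN.2.2 t h0)).congr_deriv ?_
      ring
    · intro t _ h
      simp only [hNτ] at h
      exact mul_nonpos_of_nonneg_of_nonpos (hbpos t).le
        (sub_nonpos.2 (Real.exp_le_exp.2 (by linarith)))
    · intro t ht
      rw [mul_assoc]
      refine mul_le_mul_of_nonneg_left ?_ (hbpos t).le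
      have h1 := hT (t - τ) (by linarith [le_max_left T 0])
      rw [hNτ] at h1
      have h3 := Real.add_one_le_exp (Nstar t - N (t - τ))
      have h4 : Real.exp (-N (t - τ)) =
          Real.exp (-Nstar t) * Real.exp (Nstar t - N (t - τ)) := by
        rw [← Real.exp_add]; ring_nf
      have h6 := Real.exp_pos (-Nstar t)
      rw [h4]
      nlinarith
end
end
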